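/- Fix an integer k ≥ 3 and reals 2/k < c₁ ≤ c₂ < ∞. There exists a constant K such that for all positive integers m, n with c₁ ≤ m/n ≤ c₂, all ℓ ∈ {1, …, m}, and all ζ₁, ζ₂ > 0, the average over uniformly random C ∈ C_{m,n} of the number Y^{(ℓ)} of even ℓ-subsets of rows satisfies E[Y^{(ℓ)}] ≤ K · ζ₂^{−1/2} · exp(n · H_k(ℓ/m, (ζ₁,ζ₂); m/n)). -/

import Mathlib

open scoped Classical

/-- `f(x) = e^x - 1 - x`. -/
noncomputable def fEx (x : ℝ) : ℝ := Real.exp x - 1 - x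

/-- `ψ(x) = x (e^x - 1) / (e^x - 1 - x)` for `x ≠ 0`, extended by `ψ(0) = 2`. -/
noncomputable def psi (x : ℝ) : ℝ :=
  if x = 0 then 2 else x * (Real.exp x - 1) / (Real.exp x - 1 - x)

/-- The entropy function `H(α) = -α ln α - (1-α) ln(1-α)`, with `0 ln 0 = 0`
(automatic since `Real.log 0 = 0`). -/
noncomputable def Hent (a : ℝ) : ℝ := -(a * Real.log a) - (1 - a) * Real.log (1 - a)

/-- `H_k(α, (ζ₁,ζ₂); c)` with `λ` the positive root of `ψ(λ) = ck` passed explicitly: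
`c H(α) + ckα ln(α/ζ₁) + ck(1-α) ln((1-α)/ζ₂)
  + ln[(f(λ(ζ₂+ζ₁)) + f(λ(ζ₂-ζ₁))) / (2 f(λ))]`. -/
noncomputable def HkF (k : ℕ) (a z1 z2 c lam : ℝ) : ℝ :=
  c * Hent a + c * k * a * Real.log (a / z1) + c * k * (1 - a) * Real.log ((1 - a) / z2)
    + Real.log ((fEx (lam * (z2 + z1)) + fEx (lam * (z2 - z1))) / (2 * fEx lam))

/-- `C_{m,n}`: allocations of `k` distinguishable chips per row (over `m` rows)
to `n` columns, such that every column receives at least `2` chips. -/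
noncomputable def chipSet (k m n : ℕ) : Finset (Fin m × Fin k → Fin n) :=
  Finset.univ.filter (fun φ =>
    ∀ j : Fin n, 2 ≤ (Finset.univ.filter (fun p : Fin m × Fin k => φ p = j)).card)

/-- The number of `ℓ`-element sets of rows of `C = φ` whose column sums are all even. -/
noncomputable def Ycount (k m n ℓ : ℕ) (φ : Fin m × Fin k → Fin n) : ℕ :=
  (Finset.univ.filter (fun S : Finset (Fin m) =>
    S.card = ℓ ∧ ∀ j : Fin n,
      Even (∑ i ∈ S, (Finset.univ.filter (fun u : Fin k => φ (i, u) = j)).card))).card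

/-- `E[Y^{(ℓ)}]`: the average of `Ycount` over a uniformly random `C ∈ C_{m,n}`. -/
noncomputable def EY (k m n ℓ : ℕ) : ℝ :=
  (∑ φ ∈ chipSet k m n, (Ycount k m n ℓ φ : ℝ)) / ((chipSet k m n).card : ℝ)


lemma fiber_card {T : Type*} [Fintype T] [DecidableEq T] (n : ℕ) (u : Fin n → ℕ) (hu : ∑ j, u j = Fintype.card T) :
    (Finset.univ.filter (fun φ : T → Fin n =>
      ∀ j, (Finset.univ.filter (fun t => φ t = j)).card = u j)).card
      = Nat.multinomial Finset.univ u := by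
  have h1 : (∑ j : Fin n, (MvPolynomial.X j : MvPolynomial (Fin n) ℕ)) ^ (Fintype.card T)
      = ∑ φ : T → Fin n, ∏ j, MvPolynomial.X j ^ (Finset.univ.filter (fun t => φ t = j)).card := by
    have := Finset.prod_univ_sum (fun _ : T => (Finset.univ : Finset (Fin n)))
      (fun _ j => (MvPolynomial.X j : MvPolynomial (Fin n) ℕ))
    simp only [Finset.prod_const, Finset.card_univ, Fintype.piFinset_univ] at this
    rw [this]
    refine Finset.sum_congr rfl fun φ _ => ?_
    rw [← Finset.prod_fiberwise' Finset.univ φ]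
    simp
  have h2 := Finset.sum_pow_eq_sum_piAntidiag (Finset.univ : Finset (Fin n))
    (fun j => (MvPolynomial.X j : MvPolynomial (Fin n) ℕ)) (Fintype.card T)
  rw [h1] at h2
  have h3 := congrArg (MvPolynomial.coeff (Finsupp.equivFunOnFinite.symm u)) h2
  have key : ∀ v : Fin n → ℕ, (MvPolynomial.coeff (Finsupp.equivFunOnFinite.symm u)
      (∏ j, (MvPolynomial.X j : MvPolynomial (Fin n) ℕ) ^ v j)) = if v = u then 1 else 0 := by
    intro v
    have : (∏ j, (MvPolynomial.X j : MvPolynomial (Fin n) ℕ) ^ v j)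
      = MvPolynomial.monomial (Finsupp.equivFunOnFinite.symm v) 1 := by
      rw [MvPolynomial.monomial_eq, Finsupp.prod_fintype]
      · simp
      · simp
    rw [this, MvPolynomial.coeff_monomial]
    simp
  rw [MvPolynomial.coeff_sum, MvPolynomial.coeff_sum] at h3
  simp only [key] at h3
  rw [Finset.card_filter]
  simp only [← funext_iff]
  rw [h3]
  rw [Finset.sum_eq_single u]
  · have : ((Nat.multinomial Finset.univ u : ℕ) : MvPolynomial (Fin n) ℕ) = MvPolynomial.C (Nat.multinomial Finset.univ u) := by
      simp
    rw [this, MvPolynomial.coeff_C_mul, key]; simp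
  · intro v _ hv
    have : ((Nat.multinomial Finset.univ v : ℕ) : MvPolynomial (Fin n) ℕ) = MvPolynomial.C (Nat.multinomial Finset.univ v) := by
      simp
    rw [this, MvPolynomial.coeff_C_mul, key]; simp [hv]
  · intro h
    exact absurd (by simp [Finset.mem_piAntidiag, hu]) h

lemma sum_counts {T : Type*} [Fintype T] [DecidableEq T] (n : ℕ) (F : (Fin n → ℕ) → ℝ) :
    ∑ φ : T → Fin n, F (fun j => (Finset.univ.filter (fun t => φ t = j)).card)
      = (Fintype.card T).factorial *
        ∑ u ∈ Finset.piAntidiag Finset.univ (Fintype.card T), F u * ∏ j, ((u j).factorial : ℝ)⁻¹ := by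
  have hmap : ∀ φ ∈ (Finset.univ : Finset (T → Fin n)),
      (fun j => (Finset.univ.filter (fun t => φ t = j)).card) ∈
        Finset.piAntidiag (Finset.univ : Finset (Fin n)) (Fintype.card T) := by
    intro φ _
    simp only [Finset.mem_piAntidiag, Finset.mem_univ, implies_true, and_true]
    rw [← Finset.card_univ, Finset.card_eq_sum_card_fiberwise (f := φ) (t := Finset.univ)]
    simp
  rw [← Finset.sum_fiberwise_of_maps_to hmap, Finset.mul_sum]
  refine Finset.sum_congr rfl fun u hu => ?_
  have hu' : ∑ j, u j = Fintype.card T := by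
    simpa [Finset.mem_piAntidiag] using hu
  rw [Finset.sum_congr rfl (g := fun _ => F u)
    (fun φ hφ => by rw [(Finset.mem_filter.1 hφ).2])]
  have hm := fiber_card (T := T) n u hu'
  simp only [funext_iff]
  rw [Finset.sum_const, hm, nsmul_eq_mul]
  have hs := Nat.multinomial_spec (Finset.univ : Finset (Fin n)) u
  rw [hu'] at hs
  rw [← hs]
  push_cast
  rw [Finset.prod_inv_distrib]
  have : (∏ j, ((u j).factorial : ℝ)) ≠ 0 := Finset.prod_ne_zero_iff.2 fun j _ => by positivity
  field_simp

/-- EGF coefficients of `f`. -/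
noncomputable def wf (q : ℕ) : ℝ := if 2 ≤ q then ((q.factorial : ℝ))⁻¹ else 0

/-- Bivariate coefficients. -/
noncomputable def hh (p q : ℕ) : ℝ :=
  if Even p ∧ 2 ≤ p + q then ((p.factorial : ℝ))⁻¹ * ((q.factorial : ℝ))⁻¹ else 0

lemma prod_ite_all {n : ℕ} (P : Fin n → Prop) [Decidable (∀ j, P j)] [∀ j, Decidable (P j)] :
    (if ∀ j, P j then (1 : ℝ) else 0) = ∏ j, (if P j then (1 : ℝ) else 0) := by
  by_cases h : ∀ j, P j
  · simp [h]
  · rw [if_neg h]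
    push Not at h
    obtain ⟨j, hj⟩ := h
    exact (Finset.prod_eq_zero (Finset.mem_univ j) (by simp [hj])).symm

lemma card_chip (k m n : ℕ) : ((chipSet k m n).card : ℝ) = ((m * k).factorial : ℝ) *
    ∑ u ∈ Finset.piAntidiag (Finset.univ : Finset (Fin n)) (m * k), ∏ j, wf (u j) := by
  have h := sum_counts (T := Fin m × Fin k) n (fun u => if ∀ j, 2 ≤ u j then (1 : ℝ) else 0)
  simp only [Fintype.card_prod, Fintype.card_fin] at h
  unfold chipSet
  rw [Finset.card_filter]
  push_cast
  rw [h]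
  congr 1
  refine Finset.sum_congr rfl fun u _ => ?_
  rw [prod_ite_all, ← Finset.prod_mul_distrib]
  refine Finset.prod_congr rfl fun j _ => ?_
  unfold wf
  split_ifs <;> simp

abbrev ChA {m : ℕ} (k : ℕ) (S : Finset (Fin m)) := {p : Fin m × Fin k // p.1 ∈ S}
abbrev ChB {m : ℕ} (k : ℕ) (S : Finset (Fin m)) := {p : Fin m × Fin k // ¬ p.1 ∈ S}

lemma card_split (k m n : ℕ) (S : Finset (Fin m)) :
    (((chipSet k m n).filter (fun φ => ∀ j : Fin n,
      Even (∑ i ∈ S, (Finset.univ.filter (fun u : Fin k => φ (i, u) = j)).card))).card : ℝ)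
    = ((S.card * k).factorial : ℝ) * (((m - S.card) * k).factorial : ℝ) *
      ∑ u ∈ Finset.piAntidiag (Finset.univ : Finset (Fin n)) (S.card * k),
      ∑ v ∈ Finset.piAntidiag (Finset.univ : Finset (Fin n)) ((m - S.card) * k),
        ∏ j, hh (u j) (v j) := by
  have cA : Fintype.card (ChA k S) = S.card * k := by
    rw [Fintype.card_subtype]
    have : (Finset.univ.filter (fun p : Fin m × Fin k => p.1 ∈ S)) = S ×ˢ Finset.univ := by
      ext p; simp
    rw [this]; simp
  have cB : Fintype.card (ChB k S) = (m - S.card) * k := by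
    rw [Fintype.card_subtype_compl, cA]
    simp [Nat.sub_mul]
  let Q : ℕ → ℕ → Prop := fun a b => Even a ∧ 2 ≤ a + b
  have step1 : (((chipSet k m n).filter (fun φ => ∀ j : Fin n,
      Even (∑ i ∈ S, (Finset.univ.filter (fun u : Fin k => φ (i, u) = j)).card))).card : ℝ)
      = ∑ φ : Fin m × Fin k → Fin n, if ∀ j, Q
          ((Finset.univ.filter (fun t : (ChA k S) => φ t.1 = j)).card)
          ((Finset.univ.filter (fun t : (ChB k S) => φ t.1 = j)).card) then (1:ℝ) else 0 := by
    unfold chipSet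
    rw [Finset.filter_filter, Finset.card_filter]
    push_cast
    refine Finset.sum_congr rfl fun φ _ => ?_
    congr 1
    rw [← forall_and]
    refine propext (forall_congr' fun j => ?_)
    have e1 : (∑ i ∈ S, (Finset.univ.filter (fun u : Fin k => φ (i, u) = j)).card)
        = (Finset.univ.filter (fun t : (ChA k S) => φ t.1 = j)).card := by
      rw [← Finset.card_sigma]
      refine Finset.card_bij' (fun x hx => (⟨(x.1, x.2), (Finset.mem_sigma.1 hx).1⟩ : (ChA k S)))
        (fun t _ => ⟨t.1.1, t.1.2⟩) ?_ ?_ ?_ ?_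
      · intro x hx; simpa using (Finset.mem_sigma.1 hx).2
      · intro t ht; simp at ht ⊢; exact ⟨t.2, ht⟩
      · intro x hx; rfl
      · intro t ht; rfl
    have e2 : (Finset.univ.filter (fun p : Fin m × Fin k => φ p = j)).card
        = (Finset.univ.filter (fun t : (ChA k S) => φ t.1 = j)).card
          + (Finset.univ.filter (fun t : (ChB k S) => φ t.1 = j)).card := by
      rw [← Finset.card_filter_add_card_filter_not (fun p : Fin m × Fin k => p.1 ∈ S)]
      congr 1
      · refine Finset.card_bij' (fun x hx => (⟨x, (Finset.mem_filter.1 hx).2⟩ : (ChA k S)))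
          (fun t _ => t.1) ?_ ?_ ?_ ?_
        · intro x hx; simpa using (Finset.mem_filter.1 (Finset.mem_filter.1 hx).1).2
        · intro t ht; simp at ht ⊢; exact ⟨ht, t.2⟩
        · intro x hx; rfl
        · intro t ht; rfl
      · refine Finset.card_bij' (fun x hx => (⟨x, (Finset.mem_filter.1 hx).2⟩ : (ChB k S)))
          (fun t _ => t.1) ?_ ?_ ?_ ?_
        · intro x hx; simpa using (Finset.mem_filter.1 (Finset.mem_filter.1 hx).1).2
        · intro t ht; simp at ht ⊢; exact ⟨ht, t.2⟩
        · intro x hx; rfl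
        · intro t ht; rfl
    rw [e1, e2]
    exact and_comm
  rw [step1]
  have step2 : (∑ φ : Fin m × Fin k → Fin n, if ∀ j, Q
          ((Finset.univ.filter (fun t : (ChA k S) => φ t.1 = j)).card)
          ((Finset.univ.filter (fun t : (ChB k S) => φ t.1 = j)).card) then (1:ℝ) else 0)
      = ∑ α : (ChA k S) → Fin n, ∑ β : (ChB k S) → Fin n, if ∀ j, Q
          ((Finset.univ.filter (fun t : (ChA k S) => α t = j)).card)
          ((Finset.univ.filter (fun t : (ChB k S) => β t = j)).card) then (1:ℝ) else 0 := by
    rw [← Fintype.sum_prod_type']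
    exact Fintype.sum_equiv (Equiv.piEquivPiSubtypeProd (fun p : Fin m × Fin k => p.1 ∈ S)
      (fun _ => Fin n)) _ _ (fun φ => rfl)
  rw [step2]
  have step3 : ∀ α : (ChA k S) → Fin n, (∑ β : (ChB k S) → Fin n, if ∀ j, Q
          ((Finset.univ.filter (fun t : (ChA k S) => α t = j)).card)
          ((Finset.univ.filter (fun t : (ChB k S) => β t = j)).card) then (1:ℝ) else 0)
        = _ := fun α => sum_counts (T := (ChB k S)) n (fun v => if ∀ j, Q
          ((Finset.univ.filter (fun t : (ChA k S) => α t = j)).card) (v j) then (1:ℝ) else 0)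
  rw [Finset.sum_congr rfl (fun α _ => step3 α)]
  rw [sum_counts (T := (ChA k S)) n (fun u => ((Fintype.card (ChB k S)).factorial : ℝ) *
    ∑ v ∈ Finset.piAntidiag Finset.univ (Fintype.card (ChB k S)), (if ∀ j, Q (u j) (v j) then (1:ℝ) else 0)
      * ∏ j, ((v j).factorial : ℝ)⁻¹)]
  rw [cA, cB, mul_assoc]
  congr 1
  rw [Finset.mul_sum]
  refine Finset.sum_congr rfl fun u _ => ?_
  rw [mul_assoc]
  congr 1
  rw [Finset.sum_mul]
  refine Finset.sum_congr rfl fun v _ => ?_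
  rw [prod_ite_all, ← Finset.prod_mul_distrib, ← Finset.prod_mul_distrib]
  refine Finset.prod_congr rfl fun j _ => ?_
  simp only [Q, hh]
  split_ifs <;> ring

lemma numer (k m n ℓ : ℕ) :
    (∑ φ ∈ chipSet k m n, (Ycount k m n ℓ φ : ℝ))
    = (m.choose ℓ : ℝ) * (((ℓ * k).factorial : ℝ) * (((m - ℓ) * k).factorial : ℝ) *
      ∑ u ∈ Finset.piAntidiag (Finset.univ : Finset (Fin n)) (ℓ * k),
      ∑ v ∈ Finset.piAntidiag (Finset.univ : Finset (Fin n)) ((m - ℓ) * k),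
        ∏ j, hh (u j) (v j)) := by
  have h1 : ∀ φ, (Ycount k m n ℓ φ : ℝ) = ∑ S ∈ Finset.powersetCard ℓ (Finset.univ : Finset (Fin m)),
      if (∀ j : Fin n, Even (∑ i ∈ S, (Finset.univ.filter (fun u : Fin k => φ (i, u) = j)).card))
      then (1:ℝ) else 0 := by
    intro φ
    unfold Ycount
    rw [← Finset.filter_filter, Finset.card_filter]
    push_cast
    refine Finset.sum_congr ?_ fun _ _ => rfl
    ext S; simp [Finset.mem_powersetCard]
  simp only [h1]
  rw [Finset.sum_comm]
  have h2 : ∀ S ∈ Finset.powersetCard ℓ (Finset.univ : Finset (Fin m)),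
    (∑ φ ∈ chipSet k m n, if (∀ j : Fin n, Even (∑ i ∈ S, (Finset.univ.filter (fun u : Fin k => φ (i, u) = j)).card))
      then (1:ℝ) else 0) = (((ℓ * k).factorial : ℝ) * (((m - ℓ) * k).factorial : ℝ) *
      ∑ u ∈ Finset.piAntidiag (Finset.univ : Finset (Fin n)) (ℓ * k),
      ∑ v ∈ Finset.piAntidiag (Finset.univ : Finset (Fin n)) ((m - ℓ) * k),
        ∏ j, hh (u j) (v j)) := by
    intro S hS
    have hc : S.card = ℓ := (Finset.mem_powersetCard.1 hS).2
    have := card_split k m n S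
    rw [hc] at this
    rw [← this, Finset.card_filter]
    push_cast
    rfl
  rw [Finset.sum_congr rfl h2, Finset.sum_const, Finset.card_powersetCard]
  simp

lemma ps_prod {ι : Type*} (s : Finset ι) (P : ι → PowerSeries ℂ) (z : ℂ)
    (h : ∀ i ∈ s, Summable (fun q => ‖PowerSeries.coeff q (P i) * z ^ q‖)) :
    Summable (fun q => ‖PowerSeries.coeff q (∏ i ∈ s, P i) * z ^ q‖) ∧
    ∑' q, PowerSeries.coeff q (∏ i ∈ s, P i) * z ^ q
      = ∏ i ∈ s, ∑' q, PowerSeries.coeff q (P i) * z ^ q := by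
  induction s using Finset.induction_on with
  | empty =>
    have h0 : ∀ q, q ≠ 0 → PowerSeries.coeff q (1 : PowerSeries ℂ) * z ^ q = 0 := by
      intro q hq; simp [PowerSeries.coeff_one, hq]
    constructor
    · refine summable_of_ne_finset_zero (s := {0}) ?_
      intro q hq
      simp only [Finset.mem_singleton] at hq
      simp only [Finset.prod_empty]
      rw [h0 q hq]; simp
    · simp only [Finset.prod_empty]
      rw [tsum_eq_single 0 h0]; simp
  | insert a s ha ih =>
    have ih' := ih fun i hi => h i (Finset.mem_insert_of_mem hi)
    have hP := h a (Finset.mem_insert_self a s)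
    have key : ∀ q, PowerSeries.coeff q (∏ i ∈ insert a s, P i) * z ^ q
      = ∑ kl ∈ Finset.HasAntidiagonal.antidiagonal q, (PowerSeries.coeff kl.1 (P a) * z ^ kl.1) *
        (PowerSeries.coeff kl.2 (∏ i ∈ s, P i) * z ^ kl.2) := by
      intro q
      rw [Finset.prod_insert ha, PowerSeries.coeff_mul, Finset.sum_mul]
      refine Finset.sum_congr rfl fun kl hkl => ?_
      rw [← Finset.HasAntidiagonal.mem_antidiagonal.1 hkl, pow_add]; ring
    have r1 := summable_norm_sum_mul_antidiagonal_of_summable_norm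
      (f := fun q => PowerSeries.coeff q (P a) * z ^ q)
      (g := fun q => PowerSeries.coeff q (∏ i ∈ s, P i) * z ^ q) hP ih'.1
    have r2 := tsum_mul_tsum_eq_tsum_sum_antidiagonal_of_summable_norm
      (f := fun q => PowerSeries.coeff q (P a) * z ^ q)
      (g := fun q => PowerSeries.coeff q (∏ i ∈ s, P i) * z ^ q) hP ih'.1
    constructor
    · refine r1.congr fun q => ?_
      rw [key q]
    · rw [Finset.prod_insert (f := fun i => ∑' q, PowerSeries.coeff q (P i) * z ^ q) ha, ← ih'.2, r2]
      exact tsum_congr key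

lemma coeff_prod_pi {n : ℕ} (w : Fin n → ℕ → ℂ) (b : ℕ) :
    ∑ v ∈ Finset.piAntidiag (Finset.univ : Finset (Fin n)) b, ∏ j, w j (v j)
      = PowerSeries.coeff b (∏ j, PowerSeries.mk (w j)) := by
  rw [PowerSeries.coeff_prod]
  refine Finset.sum_bij' (fun v _ => Finsupp.equivFunOnFinite.symm v) (fun l _ => l) ?_ ?_ ?_ ?_ ?_
  · intro v hv
    simpa [Finset.mem_piAntidiag, Finset.mem_finsuppAntidiag] using hv
  · intro l hl
    simpa [Finset.mem_piAntidiag, Finset.mem_finsuppAntidiag] using hl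
  · intro v hv; rfl
  · intro l hl; ext; rfl
  · intro v hv; simp

lemma orth (d : ℤ) : ∫ θ in (-Real.pi)..Real.pi, Complex.exp (((d : ℂ) * Complex.I) * θ)
    = if d = 0 then 2 * (Real.pi : ℂ) else 0 := by
  split_ifs with h
  · subst h; simp; ring
  · have hd : ((d : ℂ) * Complex.I) ≠ 0 := by simp [h]
    rw [integral_exp_mul_complex hd]
    have : Complex.exp ((d : ℂ) * Complex.I * (Real.pi : ℝ)) = Complex.exp ((d : ℂ) * Complex.I * ((-Real.pi : ℝ) : ℂ)) := by
      rw [Complex.exp_eq_exp_iff_exists_int]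
      exact ⟨d, by push_cast; ring⟩
    rw [this]; simp

lemma coeff_integral (c : ℕ → ℂ) (y : ℝ) (hy : 0 ≤ y) (hs : Summable (fun q => ‖c q‖ * y ^ q)) (b : ℕ) :
    ∫ θ in (-Real.pi)..Real.pi, (∑' q, c q * ((y : ℂ) * Complex.exp (θ * Complex.I)) ^ q)
        * Complex.exp (-(b : ℂ) * Complex.I * θ) = 2 * Real.pi * (c b * y ^ b) := by
  have hcont : ∀ q, Continuous (fun θ : ℝ => c q * ((y : ℂ) * Complex.exp (θ * Complex.I)) ^ q
        * Complex.exp (-(b : ℂ) * Complex.I * θ)) := by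
    intro q; fun_prop
  have hn1 : ∀ θ : ℝ, ‖Complex.exp (-(b : ℂ) * Complex.I * θ)‖ = 1 := by
    intro θ; rw [Complex.norm_exp]; simp
  have hnorm : ∀ q (θ : ℝ), ‖c q * ((y : ℂ) * Complex.exp (θ * Complex.I)) ^ q
        * Complex.exp (-(b : ℂ) * Complex.I * θ)‖ = ‖c q‖ * y ^ q := by
    intro q θ
    rw [norm_mul, hn1, norm_mul, norm_pow, norm_mul, Complex.norm_exp_ofReal_mul_I]
    simp [abs_of_nonneg hy]
  have H := intervalIntegral.hasSum_intervalIntegral_of_summable_norm (a := -Real.pi) (b := Real.pi) (f := fun q => ⟨_, hcont q⟩) (E := ℂ) ?_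
  · have e1 : ∀ q, ∫ θ in (-Real.pi)..Real.pi, (c q * ((y : ℂ) * Complex.exp (θ * Complex.I)) ^ q
        * Complex.exp (-(b : ℂ) * Complex.I * θ)) = if q = b then 2 * Real.pi * (c b * y ^ b) else 0 := by
      intro q
      have : ∀ θ : ℝ, (c q * ((y : ℂ) * Complex.exp (θ * Complex.I)) ^ q
        * Complex.exp (-(b : ℂ) * Complex.I * θ)) = (c q * y ^ q) * Complex.exp (((((q : ℤ) - b : ℤ) : ℂ) * Complex.I) * θ) := by
        intro θ
        rw [mul_pow, ← Complex.exp_nat_mul, mul_assoc (c q), mul_assoc (c q), mul_assoc ((y : ℂ) ^ q), ← Complex.exp_add]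
        congr 3
        push_cast; ring
      simp only [this]
      rw [intervalIntegral.integral_const_mul, orth]
      by_cases hqb : q = b
      · subst hqb; simp; ring
      · rw [if_neg hqb, if_neg (by omega)]; simp
    simp only [ContinuousMap.coe_mk, e1] at H
    have H2 := H.tsum_eq
    rw [tsum_ite_eq] at H2
    rw [H2]
    refine intervalIntegral.integral_congr fun θ _ => ?_
    simp only [tsum_mul_right]
  · refine Summable.of_nonneg_of_le (fun _ => norm_nonneg _) (fun q => ?_) hs
    rw [ContinuousMap.norm_le _ (by positivity)]
    intro x
    simp only [ContinuousMap.restrict_apply, ContinuousMap.coe_mk, hnorm, le_refl]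

/-- Cauchy formula for the product. -/
lemma cauchy_prod {n : ℕ} (w : Fin n → ℕ → ℝ) (y : ℝ) (hy : 0 ≤ y)
    (H : Fin n → ℂ → ℂ) (hH : ∀ j z, HasSum (fun q => (w j q : ℂ) * z ^ q) (H j z))
    (hs : ∀ j, Summable (fun q => ‖(w j q : ℂ)‖ * y ^ q)) (b : ℕ) :
    ∫ θ in (-Real.pi)..Real.pi, (∏ j, H j ((y : ℂ) * Complex.exp (θ * Complex.I)))
        * Complex.exp (-(b : ℂ) * Complex.I * θ)
     = ((2 * Real.pi * ((∑ v ∈ Finset.piAntidiag (Finset.univ : Finset (Fin n)) b, ∏ j, w j (v j)) * y ^ b) : ℝ) : ℂ) := by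
  have hnz : ∀ θ : ℝ, ‖((y : ℂ) * Complex.exp (θ * Complex.I))‖ = y := by
    intro θ
    rw [norm_mul, Complex.norm_exp_ofReal_mul_I]; simp [abs_of_nonneg hy]
  have hP := fun θ : ℝ => ps_prod (Finset.univ : Finset (Fin n)) (fun j => PowerSeries.mk (fun q => (w j q : ℂ)))
    ((y : ℂ) * Complex.exp (θ * Complex.I)) (by
      intro j _
      simp only [PowerSeries.coeff_mk, norm_mul, norm_pow, hnz]
      simpa [abs_of_nonneg hy] using hs j)
  have hsum := (hP 0).1
  simp only [norm_mul, norm_pow] at hsum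
  have h0 := hnz 0
  rw [norm_mul] at h0
  rw [h0] at hsum
  have := coeff_integral (fun q => PowerSeries.coeff q (∏ j, PowerSeries.mk (fun q => (w j q : ℂ)))) y hy hsum b
  rw [← coeff_prod_pi] at this
  push_cast
  rw [← this]
  refine intervalIntegral.integral_congr fun θ _ => ?_
  rw [(hP θ).2]
  congr 1
  refine Finset.prod_congr rfl fun j _ => ?_
  simp only [PowerSeries.coeff_mk]
  exact ((hH j _).tsum_eq).symm

lemma hasSum_expC (z : ℂ) : HasSum (fun q : ℕ => z ^ q / (q.factorial : ℂ)) (Complex.exp z) := by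
  rw [Complex.exp_eq_exp_ℂ]; exact NormedSpace.expSeries_div_hasSum_exp z

lemma hasSum_expR (z : ℝ) : HasSum (fun q : ℕ => z ^ q / (q.factorial : ℝ)) (Real.exp z) := by
  rw [Real.exp_eq_exp_ℝ]; exact NormedSpace.expSeries_div_hasSum_exp z

/-- Complex `f`. -/
noncomputable def fC (z : ℂ) : ℂ := Complex.exp z - 1 - z

lemma fC_ofReal (y : ℝ) : fC (y : ℂ) = (fEx y : ℂ) := by
  simp [fC, fEx]

lemma hasSum_fC (z : ℂ) : HasSum (fun q : ℕ => (wf q : ℂ) * z ^ q) (fC z) := by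
  have h1 := hasSum_expC z
  have h2 := (hasSum_sum_of_ne_finset_zero (L := SummationFilter.unconditional ℕ) (f := fun q : ℕ => if q < 2 then z ^ q / (q.factorial : ℂ) else 0)
    (s := Finset.range 2) (by intro b hb; simp at hb; simp; omega))
  have h3 := h1.sub h2
  have e : Complex.exp z - ∑ b ∈ Finset.range 2, (if b < 2 then z ^ b / (b.factorial : ℂ) else 0) = fC z := by
    simp [Finset.sum_range_succ, fC]; ring
  rw [e] at h3
  refine h3.congr_fun ?_ |> fun h => h
  intro q
  unfold wf
  by_cases hq : 2 ≤ q
  · simp [hq, Nat.not_lt.2 hq]; ring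
  · simp [hq, Nat.lt_of_not_le hq]

lemma hasSum_fEx (y : ℝ) : HasSum (fun q : ℕ => wf q * y ^ q) (fEx y) := by
  have := hasSum_fC (y : ℂ)
  rw [fC_ofReal] at this
  exact_mod_cast this

noncomputable def qc (q : ℕ) : ℝ := ((2 / 3 : ℝ) ^ q - (-1 / 3) ^ q + 3 * q * (-1 / 3) ^ q) / q.factorial

lemma qc_aux : ∀ t : ℕ, 3 * (2 * t + 1) - 1 ≤ 2 ^ (2 * t + 1)
  | 0 => by norm_num
  | 1 => by norm_num
  | t + 2 => by
    have := qc_aux (t + 1)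
    have e : 2 ^ (2 * (t + 2) + 1) = 4 * 2 ^ (2 * (t + 1) + 1) := by ring
    omega

lemma qc_nonneg (q : ℕ) : 0 ≤ qc q := by
  unfold qc
  refine div_nonneg ?_ (by positivity)
  have e1 : (2 / 3 : ℝ) ^ q = 2 ^ q * (1 / 3) ^ q := by rw [← mul_pow]; norm_num
  have e2 : (-1 / 3 : ℝ) ^ q = (-1) ^ q * (1 / 3) ^ q := by rw [← mul_pow]; norm_num
  rw [e1, e2]
  have : (2 : ℝ) ^ q * (1 / 3) ^ q - (-1) ^ q * (1 / 3) ^ q + 3 * q * ((-1) ^ q * (1 / 3) ^ q)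
    = (2 ^ q + (-1) ^ q * (3 * q - 1)) * (1 / 3) ^ q := by ring
  rw [this]
  refine mul_nonneg ?_ (by positivity)
  rcases Nat.even_or_odd q with h | h
  · rw [h.neg_one_pow]
    have : (1 : ℝ) ≤ 2 ^ q := one_le_pow₀ (by norm_num)
    have : (0 : ℝ) ≤ q := by positivity
    linarith
  · rw [h.neg_one_pow]
    obtain ⟨t, rfl⟩ := h
    have h1 := qc_aux t
    have h2 : 3 * (2 * t + 1) ≤ 2 ^ (2 * t + 1) + 1 := by omega
    have h3 : (3 * (2 * t + 1) : ℝ) ≤ 2 ^ (2 * t + 1) + 1 := by exact_mod_cast h2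
    push_cast
    linarith

lemma hasSum_qc (z : ℂ) : HasSum (fun q : ℕ => (qc q : ℂ) * z ^ q) (fC z * Complex.exp (-z / 3)) := by
  have h1 := hasSum_expC (2 / 3 * z)
  have h2 := hasSum_expC (-1 / 3 * z)
  have h3 : HasSum (fun q : ℕ => -3 * q * (-1 / 3 * z) ^ q / (q.factorial : ℂ)) (z * Complex.exp (-1 / 3 * z)) := by
    rw [← hasSum_nat_add_iff' 1]
    have := h2.mul_left z
    simp only [Finset.range_one, Finset.sum_singleton, Nat.cast_zero, mul_zero, zero_mul, zero_div, sub_zero]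
    refine this.congr_fun ?_ |> fun h => h
    intro q
    have : ((q.factorial : ℕ) : ℂ) ≠ 0 := by exact_mod_cast q.factorial_ne_zero
    have : ((q : ℂ) + 1) ≠ 0 := by exact_mod_cast q.succ_ne_zero
    rw [Nat.factorial_succ, pow_succ]
    push_cast
    field_simp
  have h4 := (h1.sub h2).sub h3
  have e : Complex.exp (2 / 3 * z) - Complex.exp (-1 / 3 * z) - z * Complex.exp (-1 / 3 * z)
      = fC z * Complex.exp (-z / 3) := by
    have : Complex.exp (2 / 3 * z) = Complex.exp z * Complex.exp (-z / 3) := by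
      rw [← Complex.exp_add]; congr 1; ring
    rw [this, show (-1 / 3 * z : ℂ) = -z / 3 by ring]
    unfold fC; ring
  rw [e] at h4
  refine h4.congr_fun ?_ |> fun h => h
  intro q
  unfold qc
  push_cast
  rw [mul_pow, mul_pow]
  ring

lemma fC_norm_le (z : ℂ) : ‖fC z‖ ≤ fEx ‖z‖ * Real.exp (-(‖z‖ - z.re) / 3) := by
  have h1 := hasSum_qc z
  have h2 := hasSum_qc (‖z‖ : ℂ)
  rw [fC_ofReal] at h2
  have h3 : HasSum (fun q : ℕ => qc q * ‖z‖ ^ q) (fEx ‖z‖ * Real.exp (-‖z‖ / 3)) := by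
    have e : ((fEx ‖z‖ : ℝ) : ℂ) * Complex.exp (-(‖z‖ : ℂ) / 3) = ((fEx ‖z‖ * Real.exp (-‖z‖ / 3) : ℝ) : ℂ) := by
      push_cast; rfl
    rw [e] at h2
    exact_mod_cast h2
  have h4 := h1.norm_le_of_bounded h3 (by
    intro q
    rw [norm_mul, norm_pow, Complex.norm_real, Real.norm_of_nonneg (qc_nonneg q)])
  rw [norm_mul, Complex.norm_exp] at h4
  have e1 : (-z / 3).re = -z.re / 3 := by
    rw [show (-z / 3 : ℂ) = -z / ((3 : ℝ) : ℂ) by simp, Complex.div_ofReal_re]; simp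
  rw [e1] at h4
  have e2 : Real.exp (-(‖z‖ - z.re) / 3) = Real.exp (-‖z‖ / 3) * Real.exp (z.re / 3) := by
    rw [← Real.exp_add]; congr 1; ring
  rw [e2, ← mul_assoc]
  have := mul_le_mul_of_nonneg_right h4 (Real.exp_pos (z.re / 3)).le
  rw [mul_assoc, ← Real.exp_add] at this
  simpa [neg_div] using this

lemma fEx_pos {y : ℝ} (hy : y ≠ 0) : 0 < fEx y := by
  unfold fEx
  have := Real.add_one_lt_exp hy
  linarith

lemma fEx_nonneg (y : ℝ) : 0 ≤ fEx y := by
  unfold fEx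
  have := Real.add_one_le_exp y
  linarith

/-- row generating functions -/
noncomputable def HC (p : ℕ) (z : ℂ) : ℂ :=
  if p = 0 then fC z else if Even p then (p.factorial : ℂ)⁻¹ * Complex.exp z else 0

noncomputable def HR (p : ℕ) (y : ℝ) : ℝ :=
  if p = 0 then fEx y else if Even p then (p.factorial : ℝ)⁻¹ * Real.exp y else 0

lemma HR_nonneg (p : ℕ) (y : ℝ) : 0 ≤ HR p y := by
  unfold HR
  split_ifs
  · exact fEx_nonneg y
  · positivity
  · exact le_rfl

lemma hasSum_HC (p : ℕ) (z : ℂ) : HasSum (fun q : ℕ => (hh p q : ℂ) * z ^ q) (HC p z) := by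
  unfold HC
  split_ifs with h0 h1
  · subst h0
    have := hasSum_fC z
    refine this.congr_fun ?_ |> fun h => h
    intro q
    simp [hh, wf]
  · have h2 : 2 ≤ p := by
      obtain ⟨r, hr⟩ := h1
      omega
    refine ((hasSum_expC z).mul_left ((p.factorial : ℂ)⁻¹)).congr_fun ?_ |> fun h => h
    intro q
    have : 2 ≤ p + q := by omega
    simp [hh, h1, this]; ring
  · refine hasSum_zero.congr_fun ?_ |> fun h => h
    intro q
    simp [hh, h1]

lemma HC_norm_le (p : ℕ) (z : ℂ) : ‖HC p z‖ ≤ HR p ‖z‖ * Real.exp (-(‖z‖ - z.re) / 3) := by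
  unfold HC HR
  split_ifs with h0 h1
  · exact fC_norm_le z
  · rw [norm_mul, Complex.norm_exp, mul_assoc, ← Real.exp_add]
    simp only [norm_inv, Complex.norm_natCast]
    refine mul_le_mul_of_nonneg_left ?_ (by positivity)
    refine Real.exp_le_exp.2 ?_
    have := Complex.re_le_norm z
    linarith
  · simp

lemma HR_sum_le (a : ℕ) (x y : ℝ) (hx : 0 ≤ x) :
    ∑ p ∈ Finset.range a, HR p y * x ^ p ≤ (fEx (y + x) + fEx (y - x)) / 2 := by
  have h1 := ((((hasSum_expR x).add (hasSum_expR (-x))).mul_left (Real.exp y / 2))).sub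
    (hasSum_ite_eq 0 (1 + y))
  have e : Real.exp y / 2 * (Real.exp x + Real.exp (-x)) - (1 + y) = (fEx (y + x) + fEx (y - x)) / 2 := by
    unfold fEx
    rw [sub_eq_add_neg y x, Real.exp_add, Real.exp_add]; ring
  rw [e] at h1
  have h2 : HasSum (fun p => HR p y * x ^ p) ((fEx (y + x) + fEx (y - x)) / 2) := by
    refine h1.congr_fun ?_ |> fun h => h
    intro p
    unfold HR
    by_cases h0 : p = 0
    · subst h0; simp [fEx]; ring
    · by_cases hp : Even p
      · simp only [h0, hp, if_true, if_false, hp.neg_pow]; ring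
      · have := Nat.not_even_iff_odd.1 hp
        simp only [h0, hp, if_false, this.neg_pow]; ring
  exact sum_le_hasSum _ (fun p _ => mul_nonneg (HR_nonneg p y) (by positivity)) h2

lemma one_sub_cos_ge {θ : ℝ} (h : |θ| ≤ Real.pi) : 2 / Real.pi ^ 2 * θ ^ 2 ≤ 1 - Real.cos θ := by
  have := Real.cos_le_one_sub_mul_cos_sq h
  linarith

lemma abs_le_pi_of_mem {θ : ℝ} (h : θ ∈ Set.Ioc (-Real.pi) Real.pi) : |θ| ≤ Real.pi :=
  abs_le.2 ⟨h.1.le, h.2⟩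

lemma norm_circle (y : ℝ) (hy : 0 ≤ y) (θ : ℝ) : ‖((y : ℂ) * Complex.exp (θ * Complex.I))‖ = y := by
  rw [norm_mul, Complex.norm_exp_ofReal_mul_I]; simp [abs_of_nonneg hy]

lemma re_circle (y : ℝ) (θ : ℝ) : ((y : ℂ) * Complex.exp (θ * Complex.I)).re = y * Real.cos θ := by
  rw [Complex.re_ofReal_mul, Complex.exp_ofReal_mul_I_re]

lemma interval_gauss_le (κ : ℝ) (hκ : 0 < κ) :
    ∫ θ in (-Real.pi)..Real.pi, Real.exp (-κ * θ ^ 2) ≤ √(Real.pi / κ) := by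
  rw [← integral_gaussian, intervalIntegral.integral_of_le (by linarith [Real.pi_pos])]
  exact MeasureTheory.setIntegral_le_integral (integrable_exp_neg_mul_sq hκ)
    (Filter.Eventually.of_forall fun _ => (Real.exp_pos _).le)

noncomputable def K0 : ℝ := √(3 * Real.pi ^ 3 / 2) / (2 * Real.pi)

lemma upper1 {n : ℕ} (hn : 0 < n) (u : Fin n → ℕ) (y : ℝ) (hy : 0 < y) (b : ℕ) :
    (∑ v ∈ Finset.piAntidiag (Finset.univ : Finset (Fin n)) b, ∏ j, hh (u j) (v j)) * y ^ b
      ≤ (∏ j, HR (u j) y) * (K0 / √(n * y)) := by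
  have hpi := Real.pi_pos
  have hn' : (0 : ℝ) < n := by exact_mod_cast hn
  have hc := cauchy_prod (fun j => hh (u j)) y hy.le (fun j => HC (u j)) (fun j z => hasSum_HC (u j) z)
    (fun j => by
      have h := (hasSum_HC (u j) (y : ℂ)).summable.norm
      simpa [abs_of_pos hy] using h) b
  set κ : ℝ := 2 * (n * y) / (3 * Real.pi ^ 2) with hκ
  have hκ0 : 0 < κ := by positivity
  have hnn : 0 ≤ ∏ j, HR (u j) y := Finset.prod_nonneg fun j _ => HR_nonneg _ _
  have hb := intervalIntegral.norm_integral_le_of_norm_le (a := -Real.pi) (b := Real.pi)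
    (μ := MeasureTheory.volume)
    (f := fun θ : ℝ => (∏ j, HC (u j) ((y : ℂ) * Complex.exp (θ * Complex.I)))
        * Complex.exp (-(b : ℂ) * Complex.I * θ))
    (g := fun θ => (∏ j, HR (u j) y) * Real.exp (-κ * θ ^ 2)) (by linarith)
    (Filter.Eventually.of_forall fun θ hθ => by
      have h1 : ‖Complex.exp (-(b : ℂ) * Complex.I * θ)‖ = 1 := by
        rw [Complex.norm_exp]; simp
      rw [norm_mul, h1, mul_one, norm_prod]
      have h2 : ∀ j ∈ (Finset.univ : Finset (Fin n)), ‖HC (u j) ((y : ℂ) * Complex.exp (θ * Complex.I))‖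
          ≤ HR (u j) y * Real.exp (-(2 * y / (3 * Real.pi ^ 2)) * θ ^ 2) := by
        intro j _
        refine (HC_norm_le _ _).trans ?_
        rw [norm_circle y hy.le, re_circle]
        refine mul_le_mul_of_nonneg_left (Real.exp_le_exp.2 ?_) (HR_nonneg _ _)
        have := mul_le_mul_of_nonneg_left (one_sub_cos_ge (abs_le_pi_of_mem hθ)) hy.le
        have e : 2 * y / (3 * Real.pi ^ 2) * θ ^ 2 = (y * (2 / Real.pi ^ 2 * θ ^ 2)) / 3 := by
          field_simp
        rw [neg_mul, e]
        linarith
      refine (Finset.prod_le_prod (fun _ _ => norm_nonneg _) h2).trans (le_of_eq ?_)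
      rw [Finset.prod_mul_distrib]
      congr 1
      rw [Finset.prod_const, Finset.card_univ, Fintype.card_fin, ← Real.exp_nat_mul]
      congr 1
      rw [hκ]; ring)
    (by apply Continuous.intervalIntegrable; fun_prop)
  rw [hc, intervalIntegral.integral_const_mul] at hb
  have hb2 := hb.trans (mul_le_mul_of_nonneg_left (interval_gauss_le κ hκ0) hnn)
  rw [Complex.norm_real] at hb2
  have hb3 := (le_abs_self _).trans hb2
  have e : √(Real.pi / κ) = 2 * Real.pi * (K0 / √(n * y)) := by
    rw [show Real.pi / κ = (3 * Real.pi ^ 3 / 2) / (n * y) by rw [hκ]; field_simp]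
    rw [Real.sqrt_div (by positivity), K0]
    field_simp
  rw [e] at hb3
  have : 0 < 2 * Real.pi := by positivity
  nlinarith

lemma upper2 {n : ℕ} (hn : 0 < n) (x y : ℝ) (hx : 0 < x) (hy : 0 < y) (a b : ℕ) :
    (∑ u ∈ Finset.piAntidiag (Finset.univ : Finset (Fin n)) a,
      ∑ v ∈ Finset.piAntidiag (Finset.univ : Finset (Fin n)) b, ∏ j, hh (u j) (v j)) * (x ^ a * y ^ b)
      ≤ K0 / √(n * y) * ((fEx (y + x) + fEx (y - x)) / 2) ^ n := by
  have hK : 0 ≤ K0 / √(n * y) := by unfold K0; positivity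
  have h1 : (∑ u ∈ Finset.piAntidiag (Finset.univ : Finset (Fin n)) a,
      ∑ v ∈ Finset.piAntidiag (Finset.univ : Finset (Fin n)) b, ∏ j, hh (u j) (v j)) * (x ^ a * y ^ b)
      ≤ ∑ u ∈ Finset.piAntidiag (Finset.univ : Finset (Fin n)) a,
        (K0 / √(n * y)) * ∏ j, (HR (u j) y * x ^ u j) := by
    rw [Finset.sum_mul]
    refine Finset.sum_le_sum fun u hu => ?_
    have hu' : ∑ j, u j = a := by simpa [Finset.mem_piAntidiag] using hu
    have := mul_le_mul_of_nonneg_right (upper1 hn u y hy b) (pow_nonneg hx.le a)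
    rw [Finset.prod_mul_distrib, Finset.prod_pow_eq_pow_sum, hu']
    calc _ = _ := by ring
      _ ≤ _ := this
      _ = _ := by ring
  refine h1.trans ?_
  rw [← Finset.mul_sum]
  refine mul_le_mul_of_nonneg_left ?_ hK
  have h2 : ∑ u ∈ Finset.piAntidiag (Finset.univ : Finset (Fin n)) a, ∏ j, (HR (u j) y * x ^ u j)
      ≤ ∑ u ∈ Fintype.piFinset (fun _ : Fin n => Finset.range (a + 1)), ∏ j, (HR (u j) y * x ^ u j) := by
    refine Finset.sum_le_sum_of_subset_of_nonneg ?_ ?_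
    · intro u hu
      have hu' : ∑ j, u j = a := by simpa [Finset.mem_piAntidiag] using hu
      rw [Fintype.mem_piFinset]
      intro j
      rw [Finset.mem_range, ← hu']
      exact Nat.lt_succ_of_le (Finset.single_le_sum (f := u) (fun _ _ => Nat.zero_le _) (Finset.mem_univ j))
    · intro u _ _
      exact Finset.prod_nonneg fun j _ => mul_nonneg (HR_nonneg _ _) (by positivity)
  refine h2.trans ?_
  have h3 := Finset.prod_univ_sum (fun _ : Fin n => Finset.range (a + 1)) (fun _ p => HR p y * x ^ p)
  rw [← h3, Finset.prod_const, Finset.card_univ, Fintype.card_fin]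
  exact pow_le_pow_left₀ (Finset.sum_nonneg fun p _ => mul_nonneg (HR_nonneg _ _) (by positivity))
    (HR_sum_le _ _ _ hx.le) n

lemma wf_nonneg (q : ℕ) : 0 ≤ wf q := by unfold wf; split_ifs <;> positivity

lemma hasSum_mean (y : ℝ) : HasSum (fun q : ℕ => (q : ℝ) * (wf q * y ^ q)) (y * (Real.exp y - 1)) := by
  rw [← hasSum_nat_add_iff' 1]
  have h := ((hasSum_expR y).sub (hasSum_ite_eq 0 (1 : ℝ))).mul_left y
  simp only [Finset.range_one, Finset.sum_singleton, Nat.cast_zero, zero_mul, sub_zero]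
  refine h.congr_fun ?_ |> fun h => h
  intro q
  unfold wf
  by_cases hq : q = 0
  · subst hq; simp
  · have : 2 ≤ q + 1 := by omega
    rw [if_pos this, if_neg hq, Nat.factorial_succ]
    have h1 : ((q.factorial : ℕ) : ℝ) ≠ 0 := by exact_mod_cast q.factorial_ne_zero
    have h2 : ((q : ℝ) + 1) ≠ 0 := by exact_mod_cast q.succ_ne_zero
    push_cast
    field_simp
    ring

/-- centred characteristic function -/
noncomputable def chi (lam μ θ : ℝ) : ℂ :=
  fC ((lam : ℂ) * Complex.exp (θ * Complex.I)) / (fEx lam : ℂ) * Complex.exp (-(μ : ℂ) * Complex.I * θ)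

lemma moments (lam μ : ℝ) (hl : 0 < lam) (hμ0 : 0 ≤ μ) (hμ : lam * (Real.exp lam - 1) = μ * fEx lam)
    (M : ℝ) (hM : Real.exp (2 * μ) * fEx (Real.exp 2 * lam) / fEx lam ≤ M) :
    ∃ s2 : ℝ, 0 ≤ s2 ∧ s2 ≤ 2 * M ∧ ∀ θ : ℝ, |θ| ≤ 1 →
      ‖chi lam μ θ - ((1 - s2 * θ ^ 2 / 2 : ℝ) : ℂ)‖ ≤ 6 * M * |θ| ^ 3 := by
  have hf : 0 < fEx lam := fEx_pos hl.ne'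
  set pr : ℕ → ℝ := fun q => wf q * lam ^ q / fEx lam with hpr
  have hpr0 : ∀ q, 0 ≤ pr q := fun q => div_nonneg (mul_nonneg (wf_nonneg q) (by positivity)) hf.le
  have s0 : HasSum pr 1 := by
    have := (hasSum_fEx lam).div_const (fEx lam)
    rwa [div_self hf.ne'] at this
  have s1 : HasSum (fun q : ℕ => pr q * ((q : ℝ) - μ)) 0 := by
    have h1 := (hasSum_mean lam).div_const (fEx lam)
    rw [hμ, mul_div_assoc, div_self hf.ne', mul_one] at h1
    have h2 := h1.sub (s0.mul_left μ)
    simp only [mul_one, sub_self] at h2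
    refine h2.congr_fun ?_ |> fun h => h
    intro q
    simp only [hpr]; ring
  have sM : HasSum (fun q : ℕ => pr q * Real.exp (2 * (q + μ)))
      (Real.exp (2 * μ) * fEx (Real.exp 2 * lam) / fEx lam) := by
    have := ((hasSum_fEx (Real.exp 2 * lam)).mul_left (Real.exp (2 * μ))).div_const (fEx lam)
    refine this.congr_fun ?_ |> fun h => h
    intro q
    have e : Real.exp (2 * (q + μ)) = Real.exp (2 * μ) * Real.exp 2 ^ q := by
      rw [← Real.exp_nat_mul, ← Real.exp_add]; congr 1; ring
    simp only [hpr]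
    rw [e, mul_pow]; ring
  have habs : ∀ q : ℕ, |(q : ℝ) - μ| ≤ q + μ := fun q => by
    rw [abs_le]; constructor <;> nlinarith [(Nat.cast_nonneg q : (0 : ℝ) ≤ q)]
  have hsq : ∀ q : ℕ, pr q * ((q : ℝ) - μ) ^ 2 ≤ 2 * (pr q * Real.exp (2 * (q + μ))) := by
    intro q
    have h1 := Real.quadratic_le_exp_of_nonneg (abs_nonneg ((q : ℝ) - μ))
    have h2 : Real.exp |(q : ℝ) - μ| ≤ Real.exp (2 * (q + μ)) := Real.exp_le_exp.2 (by
      have := habs q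
      have := abs_nonneg ((q : ℝ) - μ)
      linarith)
    have h3 : ((q : ℝ) - μ) ^ 2 ≤ 2 * Real.exp (2 * (q + μ)) := by
      rw [← sq_abs]
      have := abs_nonneg ((q : ℝ) - μ)
      linarith
    have := mul_le_mul_of_nonneg_left h3 (hpr0 q)
    linarith
  have ssq : Summable (fun q : ℕ => pr q * ((q : ℝ) - μ) ^ 2) :=
    Summable.of_nonneg_of_le (fun q => mul_nonneg (hpr0 q) (sq_nonneg _)) hsq (sM.mul_left 2).summable
  obtain ⟨s2, hs2⟩ := ssq
  refine ⟨s2, hs2.nonneg fun q => mul_nonneg (hpr0 q) (sq_nonneg _), ?_, ?_⟩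
  · have := hasSum_le hsq hs2 (sM.mul_left 2)
    linarith
  · intro θ hθ
    have c0 : HasSum (fun q : ℕ => (pr q : ℂ) * Complex.exp (((q - μ) * θ : ℝ) * Complex.I)) (chi lam μ θ) := by
      have := ((hasSum_fC ((lam : ℂ) * Complex.exp (θ * Complex.I))).div_const (fEx lam : ℂ)).mul_right
        (Complex.exp (-(μ : ℂ) * Complex.I * θ))
      refine this.congr_fun ?_ |> fun h => h
      intro q
      simp only [hpr]
      have e : Complex.exp (((q - μ) * θ : ℝ) * Complex.I)
          = Complex.exp (θ * Complex.I) ^ q * Complex.exp (-(μ : ℂ) * Complex.I * θ) := by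
        rw [← Complex.exp_nat_mul, ← Complex.exp_add]; congr 1; push_cast; ring
      rw [e, mul_pow]; push_cast; ring
    have cr : HasSum (fun q : ℕ => pr q * (1 - (((q : ℝ) - μ) * θ) ^ 2 / 2)) (1 - s2 * θ ^ 2 / 2) := by
      have := s0.sub ((hs2.mul_right (θ ^ 2)).div_const 2)
      refine this.congr_fun ?_ |> fun h => h
      intro q; ring
    have ci : HasSum (fun q : ℕ => pr q * (((q : ℝ) - μ) * θ)) 0 := by
      have := s1.mul_right θ
      rw [zero_mul] at this
      refine this.congr_fun ?_ |> fun h => h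
      intro q; ring
    have cr' : HasSum (fun q : ℕ => ((pr q * (1 - (((q : ℝ) - μ) * θ) ^ 2 / 2) : ℝ) : ℂ))
      ((1 - s2 * θ ^ 2 / 2 : ℝ) : ℂ) := by exact_mod_cast cr
    have ci' : HasSum (fun q : ℕ => ((pr q * (((q : ℝ) - μ) * θ) : ℝ) : ℂ)) 0 := by
      rw [← Complex.ofReal_zero, Complex.hasSum_ofReal]; exact ci
    have tot := (c0.sub cr').sub (ci'.mul_right Complex.I)
    rw [zero_mul, sub_zero] at tot
    refine (tot.norm_le_of_bounded (sM.mul_left (6 * |θ| ^ 3)) ?_).trans ?_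
    · intro q
      set t : ℝ := ((q : ℝ) - μ) * θ with ht
      have hb := Complex.norm_exp_sub_sum_le_norm_mul_exp ((t : ℂ) * Complex.I) 3
      have e1 : (pr q : ℂ) * Complex.exp ((t : ℝ) * Complex.I) - ((pr q * (1 - t ^ 2 / 2) : ℝ) : ℂ)
          - ((pr q * t : ℝ) : ℂ) * Complex.I
        = (pr q : ℂ) * (Complex.exp ((t : ℂ) * Complex.I) - ∑ m ∈ Finset.range 3, ((t : ℂ) * Complex.I) ^ m / m.factorial) := by
        simp only [Finset.sum_range_succ, Finset.sum_range_zero, mul_pow, Complex.I_sq]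
        push_cast
        simp [Nat.factorial]
        ring
      rw [e1, norm_mul, Complex.norm_real, Real.norm_of_nonneg (hpr0 q)]
      have e2 : ‖(t : ℂ) * Complex.I‖ = |t| := by simp
      rw [e2] at hb
      have ht1 : |t| = |(q : ℝ) - μ| * |θ| := abs_mul _ _
      set a := |(q : ℝ) - μ| with ha
      have ha0 : 0 ≤ a := abs_nonneg _
      have hth0 := abs_nonneg θ
      have h6 : a ^ 3 ≤ 6 * Real.exp a := by
        have := Real.pow_div_factorial_le_exp a ha0 3
        simp [Nat.factorial] at this
        linarith
      have h7 : Real.exp |t| ≤ Real.exp a := Real.exp_le_exp.2 (by rw [ht1]; nlinarith)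
      have h8 : Real.exp a * Real.exp a ≤ Real.exp (2 * (q + μ)) := by
        rw [← Real.exp_add]; refine Real.exp_le_exp.2 ?_
        have := habs q
        linarith
      have h9 : |t| ^ 3 * Real.exp |t| ≤ 6 * |θ| ^ 3 * Real.exp (2 * (q + μ)) := by
        calc |t| ^ 3 * Real.exp |t| ≤ |t| ^ 3 * Real.exp a := by gcongr
          _ = |θ| ^ 3 * (a ^ 3 * Real.exp a) := by rw [ht1]; ring
          _ ≤ |θ| ^ 3 * (6 * Real.exp a * Real.exp a) := by gcongr
          _ = 6 * |θ| ^ 3 * (Real.exp a * Real.exp a) := by ring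
          _ ≤ _ := by gcongr
      calc _ ≤ pr q * (6 * |θ| ^ 3 * Real.exp (2 * (q + μ))) :=
            mul_le_mul_of_nonneg_left (hb.trans h9) (hpr0 q)
        _ = _ := by ring
    · have : 0 ≤ 6 * |θ| ^ 3 := by positivity
      calc _ ≤ 6 * |θ| ^ 3 * M := mul_le_mul_of_nonneg_left hM this
        _ = _ := by ring

lemma pow_sub_pow_norm (a b : ℂ) (ha : ‖a‖ ≤ 1) (hb : ‖b‖ ≤ 1) (n : ℕ) :
    ‖a ^ n - b ^ n‖ ≤ n * ‖a - b‖ := by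
  induction n with
  | zero => simp
  | succ n ih =>
    have e : a ^ (n + 1) - b ^ (n + 1) = a * (a ^ n - b ^ n) + (a - b) * b ^ n := by ring
    rw [e]
    refine (norm_add_le _ _).trans ?_
    rw [norm_mul, norm_mul, norm_pow]
    have h1 : ‖b‖ ^ n ≤ 1 := pow_le_one₀ (norm_nonneg _) hb
    have h2 := norm_nonneg (a - b)
    have h3 := norm_nonneg (a ^ n - b ^ n)
    push_cast
    nlinarith

lemma exp_neg_bound (s : ℝ) (hs : 0 ≤ s) : |(1 - s) - Real.exp (-s)| ≤ s ^ 2 := by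
  have h1 := Real.add_one_le_exp (-s)
  have h2 := Real.add_one_le_exp s
  have h3 : Real.exp (-s) * Real.exp s = 1 := by rw [← Real.exp_add]; simp
  have h4 := Real.exp_pos (-s)
  have h5 : Real.exp (-s) * (1 + s) ≤ 1 := by nlinarith
  have h6 : Real.exp (-s) ≤ 1 - s + s ^ 2 := by
    by_contra h
    push Not at h
    have : (1 - s + s ^ 2) * (1 + s) < Real.exp (-s) * (1 + s) := by
      apply mul_lt_mul_of_pos_right h; linarith
    nlinarith [pow_nonneg hs 3]
  rw [abs_le]; constructor <;> linarith

lemma chi_norm (lam μ θ : ℝ) (hl : 0 < lam) : ‖chi lam μ θ‖ ≤ Real.exp (-(lam * (1 - Real.cos θ)) / 3) := by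
  have hf : 0 < fEx lam := fEx_pos hl.ne'
  have h1 : ‖Complex.exp (-(μ : ℂ) * Complex.I * θ)‖ = 1 := by
    rw [Complex.norm_exp]; simp
  unfold chi
  rw [norm_mul, h1, mul_one, norm_div, Complex.norm_real, Real.norm_of_nonneg hf.le, div_le_iff₀ hf]
  have := fC_norm_le ((lam : ℂ) * Complex.exp (θ * Complex.I))
  rw [norm_circle lam hl.le, re_circle] at this
  rw [show lam * (1 - Real.cos θ) = lam - lam * Real.cos θ by ring, mul_comm (Real.exp _) (fEx lam)]
  exact this

lemma chi_cont (lam μ : ℝ) : Continuous (chi lam μ) := by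
  unfold chi fC; fun_prop

lemma coef_int {n : ℕ} (hn : 0 < n) (N : ℕ) (lam : ℝ) (hl : 0 < lam) :
    2 * Real.pi * ((∑ u ∈ Finset.piAntidiag (Finset.univ : Finset (Fin n)) N, ∏ j, wf (u j)) * lam ^ N)
      = fEx lam ^ n * ∫ θ in (-Real.pi)..Real.pi, (chi lam ((N : ℝ) / n) θ ^ n).re := by
  have hf : 0 < fEx lam := fEx_pos hl.ne'
  have hfc : (fEx lam : ℂ) ≠ 0 := by exact_mod_cast hf.ne'
  have hnc : (n : ℂ) ≠ 0 := by exact_mod_cast hn.ne'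
  have h := cauchy_prod (n := n) (fun _ => wf) lam hl.le (fun _ => fC) (fun _ z => hasSum_fC z)
    (fun _ => by
      refine (hasSum_fEx lam).summable.congr ?_
      intro q
      rw [Complex.norm_real, Real.norm_of_nonneg (wf_nonneg q)]) N
  have e : ∀ θ : ℝ, (∏ _j : Fin n, fC ((lam : ℂ) * Complex.exp (θ * Complex.I))) * Complex.exp (-(N : ℂ) * Complex.I * θ)
      = ((fEx lam ^ n : ℝ) : ℂ) * (chi lam ((N : ℝ) / n) θ ^ n) := by
    intro θ
    rw [Finset.prod_const, Finset.card_univ, Fintype.card_fin]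
    unfold chi
    rw [mul_pow, div_pow, ← Complex.exp_nat_mul]
    push_cast
    rw [← mul_assoc, mul_div_cancel₀ _ (pow_ne_zero _ hfc)]
    congr 2
    field_simp
  simp only [e] at h
  rw [intervalIntegral.integral_const_mul] at h
  have h2 := Complex.reCLM.intervalIntegral_comp_comm (μ := MeasureTheory.volume) (a := -Real.pi) (b := Real.pi)
    (f := fun θ : ℝ => chi lam ((N : ℝ) / n) θ ^ n)
    (((chi_cont lam ((N : ℝ) / n)).pow n).intervalIntegrable _ _)
  simp only [Complex.reCLM_apply] at h2
  rw [h2]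
  have h3 := congrArg Complex.re h
  rw [Complex.re_ofReal_mul, Complex.ofReal_re] at h3
  exact h3.symm

lemma ind_int (a c : ℝ) (h0 : 0 ≤ a) (h1 : a ≤ 1) :
    IntervalIntegrable (fun θ => (Set.Icc (-a) a).indicator (fun _ => c) θ) MeasureTheory.volume (-Real.pi) Real.pi ∧
    ∫ θ in (-Real.pi)..Real.pi, (Set.Icc (-a) a).indicator (fun _ => c) θ = 2 * a * c := by
  have hp := Real.pi_gt_three
  constructor
  · rw [intervalIntegrable_iff_integrableOn_Ioc_of_le (by linarith)]
    refine MeasureTheory.Integrable.indicator ?_ measurableSet_Icc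
    simp
  · rw [intervalIntegral.integral_of_le (by linarith), MeasureTheory.setIntegral_indicator measurableSet_Icc]
    have : Set.Ioc (-Real.pi) Real.pi ∩ Set.Icc (-a) a = Set.Icc (-a) a := by
      apply Set.inter_eq_self_of_subset_right
      intro x hx
      exact ⟨by linarith [hx.1], by linarith [hx.2]⟩
    rw [this, MeasureTheory.setIntegral_const, MeasureTheory.measureReal_def, Real.volume_Icc,
      ENNReal.toReal_ofReal (by linarith), smul_eq_mul]
    ring

lemma int_lower (F : ℝ → ℝ) (hF : Continuous F) (M B κ T r : ℝ) (hM : 0 ≤ M) (hB : 0 ≤ B) (hκ : 0 < κ)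
    (hT : 1 ≤ T) (hr : T ≤ r)
    (near : ∀ θ, |θ| ≤ 1 → Real.exp (-(r ^ 2 * (M * θ ^ 2))) - r ^ 2 * (B * |θ| ^ 3) ≤ F θ)
    (far : ∀ θ, |θ| ≤ Real.pi → -Real.exp (-(2 * κ * r ^ 2 * θ ^ 2)) ≤ F θ) :
    (1 / r) * (2 * Real.exp (-M) - 2 * B * T ^ 4 / r - Real.exp (-(κ * T ^ 2)) * √(Real.pi / κ))
      ≤ ∫ θ in (-Real.pi)..Real.pi, F θ := by
  have hp := Real.pi_gt_three
  have hr0 : 0 < r := by linarith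
  have hT0 : 0 < T := by linarith
  have i1 := ind_int (1 / r) (Real.exp (-M)) (by positivity) (by rw [div_le_one hr0]; linarith)
  have i2 := ind_int (T / r) (r ^ 2 * (B * (T / r) ^ 3)) (by positivity) (by rw [div_le_one hr0]; linarith)
  have i3 : IntervalIntegrable (fun θ => Real.exp (-(κ * T ^ 2)) * Real.exp (-(κ * r ^ 2) * θ ^ 2)) MeasureTheory.volume (-Real.pi) Real.pi :=
    Continuous.intervalIntegrable (by fun_prop) _ _
  have g := interval_gauss_le (κ * r ^ 2) (by positivity)
  have e3 : √(Real.pi / (κ * r ^ 2)) = 1 / r * √(Real.pi / κ) := by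
    rw [show Real.pi / (κ * r ^ 2) = (1 / r) ^ 2 * (Real.pi / κ) by field_simp, Real.sqrt_mul (by positivity),
      Real.sqrt_sq (by positivity)]
  have key : ∫ θ in (-Real.pi)..Real.pi, ((Set.Icc (-(1 / r)) (1 / r)).indicator (fun _ => Real.exp (-M)) θ
      - (Set.Icc (-(T / r)) (T / r)).indicator (fun _ => r ^ 2 * (B * (T / r) ^ 3)) θ
      - Real.exp (-(κ * T ^ 2)) * Real.exp (-(κ * r ^ 2) * θ ^ 2)) ≤ ∫ θ in (-Real.pi)..Real.pi, F θ := by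
    refine intervalIntegral.integral_mono_on (by linarith) ((i1.1.sub i2.1).sub i3) (hF.intervalIntegrable _ _) ?_
    intro θ hθ
    have hθ' : |θ| ≤ Real.pi := abs_le.2 hθ
    have ep : 0 < Real.exp (-(κ * T ^ 2)) * Real.exp (-(κ * r ^ 2) * θ ^ 2) := by positivity
    have hTr : T / r ≤ 1 := by rw [div_le_one hr0]; linarith
    have h1T : 1 / r ≤ T / r := by gcongr
    by_cases h2 : |θ| ≤ T / r
    · rw [Set.indicator_of_mem (s := Set.Icc (-(T / r)) (T / r)) (abs_le.1 h2)]
      have hn := near θ (h2.trans hTr)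
      have hb : r ^ 2 * (B * |θ| ^ 3) ≤ r ^ 2 * (B * (T / r) ^ 3) := by gcongr
      by_cases h1 : |θ| ≤ 1 / r
      · rw [Set.indicator_of_mem (s := Set.Icc (-(1 / r)) (1 / r)) (abs_le.1 h1)]
        have : Real.exp (-M) ≤ Real.exp (-(r ^ 2 * (M * θ ^ 2))) := by
          apply Real.exp_le_exp.2
          have : θ ^ 2 ≤ (1 / r) ^ 2 := by rw [← sq_abs θ]; gcongr
          have h : r ^ 2 * (M * θ ^ 2) ≤ r ^ 2 * (M * (1 / r) ^ 2) := by gcongr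
          have : r ^ 2 * (M * (1 / r) ^ 2) = M := by field_simp
          linarith
        linarith
      · rw [Set.indicator_of_notMem (s := Set.Icc (-(1 / r)) (1 / r)) (fun h => h1 (abs_le.2 h))]
        have := Real.exp_pos (-(r ^ 2 * (M * θ ^ 2)))
        linarith
    · rw [Set.indicator_of_notMem (s := Set.Icc (-(T / r)) (T / r)) (fun h => h2 (abs_le.2 h)),
        Set.indicator_of_notMem (s := Set.Icc (-(1 / r)) (1 / r)) (fun h => h2 ((abs_le.2 h).trans h1T))]
      have hf := far θ hθ'
      have : Real.exp (-(2 * κ * r ^ 2 * θ ^ 2)) ≤ Real.exp (-(κ * T ^ 2)) * Real.exp (-(κ * r ^ 2) * θ ^ 2) := by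
        rw [← Real.exp_add]
        apply Real.exp_le_exp.2
        push Not at h2
        have h3 : T ≤ r * |θ| := by rw [div_lt_iff₀ hr0] at h2; linarith
        have h4 : T ^ 2 ≤ r ^ 2 * θ ^ 2 := by rw [← sq_abs θ, ← mul_pow]; gcongr
        have h5 : κ * T ^ 2 ≤ κ * (r ^ 2 * θ ^ 2) := by gcongr
        linarith
      linarith
  rw [intervalIntegral.integral_sub (i1.1.sub i2.1) i3, intervalIntegral.integral_sub i1.1 i2.1, i1.2, i2.2,
    intervalIntegral.integral_const_mul] at key
  rw [e3] at g
  have g2 := mul_le_mul_of_nonneg_left g (Real.exp_pos (-(κ * T ^ 2))).le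
  have e4 : 2 * (T / r) * (r ^ 2 * (B * (T / r) ^ 3)) = 1 / r * (2 * B * T ^ 4 / r) := by field_simp
  rw [e4] at key
  calc _ = 2 * (1 / r) * Real.exp (-M) - 1 / r * (2 * B * T ^ 4 / r) - Real.exp (-(κ * T ^ 2)) * (1 / r * √(Real.pi / κ)) := by ring
    _ ≤ _ := by linarith

lemma fEx_ge (x : ℝ) (hx : 0 ≤ x) : x ^ 2 / 2 ≤ fEx x := by
  have := Real.quadratic_le_exp_of_nonneg hx
  unfold fEx; linarith

lemma fEx_le_exp (x : ℝ) (hx : 0 ≤ x) : fEx x ≤ Real.exp x := by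
  unfold fEx; linarith

lemma far_bound (lam0 lam μ θ : ℝ) (h0 : 0 < lam0) (hl : lam0 ≤ lam) (hθ : |θ| ≤ Real.pi) (n : ℕ) :
    -Real.exp (-(2 * (lam0 / (3 * Real.pi ^ 2)) * n * θ ^ 2)) ≤ (chi lam μ θ ^ n).re := by
  have h1 := chi_norm lam μ θ (h0.trans_le hl)
  have h2 := one_sub_cos_ge hθ
  have hp := Real.pi_pos
  have h3 : ‖chi lam μ θ ^ n‖ ≤ Real.exp (-(2 * (lam0 / (3 * Real.pi ^ 2)) * n * θ ^ 2)) := by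
    rw [norm_pow]
    calc _ ≤ Real.exp (-(lam * (1 - Real.cos θ)) / 3) ^ n := by gcongr
      _ = Real.exp (n * (-(lam * (1 - Real.cos θ)) / 3)) := by rw [← Real.exp_nat_mul]
      _ ≤ _ := by
        apply Real.exp_le_exp.2
        have h4 : lam0 * (2 / Real.pi ^ 2 * θ ^ 2) ≤ lam * (1 - Real.cos θ) := by
          have : 0 ≤ 2 / Real.pi ^ 2 * θ ^ 2 := by positivity
          nlinarith
        have h5 : (n : ℝ) * (lam0 * (2 / Real.pi ^ 2 * θ ^ 2)) ≤ n * (lam * (1 - Real.cos θ)) := by gcongr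
        have h6 : 2 * (lam0 / (3 * Real.pi ^ 2)) * n * θ ^ 2 = (n : ℝ) * (lam0 * (2 / Real.pi ^ 2 * θ ^ 2)) / 3 := by
          field_simp
        rw [h6]; linarith
  have := (abs_le.1 (Complex.abs_re_le_norm (chi lam μ θ ^ n))).1
  linarith

lemma near_bound (lam μ : ℝ) (hl : 0 < lam) (hμ0 : 0 ≤ μ) (hμ : lam * (Real.exp lam - 1) = μ * fEx lam)
    (M : ℝ) (hM0 : 0 ≤ M) (hM : Real.exp (2 * μ) * fEx (Real.exp 2 * lam) / fEx lam ≤ M) (θ : ℝ) (hθ : |θ| ≤ 1) (n : ℕ) :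
    Real.exp (-(n * (M * θ ^ 2))) - n * ((6 * M + M ^ 2) * |θ| ^ 3) ≤ (chi lam μ θ ^ n).re := by
  obtain ⟨s2, hs0, hs1, hs⟩ := moments lam μ hl hμ0 hμ M hM
  have h1 := hs θ hθ
  set s := s2 * θ ^ 2 / 2 with hsdef
  have hs00 : 0 ≤ s := by positivity
  have hsM : s ≤ M * θ ^ 2 := by
    have : s2 * θ ^ 2 ≤ 2 * M * θ ^ 2 := by gcongr
    rw [hsdef]; linarith
  have h2 := exp_neg_bound s hs00
  have h3 : ‖chi lam μ θ - ((Real.exp (-s) : ℝ) : ℂ)‖ ≤ (6 * M + M ^ 2) * |θ| ^ 3 := by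
    have h4 : ‖((1 - s : ℝ) : ℂ) - ((Real.exp (-s) : ℝ) : ℂ)‖ ≤ M ^ 2 * |θ| ^ 3 := by
      rw [← Complex.ofReal_sub, Complex.norm_real, Real.norm_eq_abs]
      have h5 : s ^ 2 ≤ (M * θ ^ 2) ^ 2 := by gcongr
      have h6 : (M * θ ^ 2) ^ 2 = M ^ 2 * (|θ| ^ 3 * |θ|) := by rw [← sq_abs θ]; ring
      have h7 : |θ| ^ 3 * |θ| ≤ |θ| ^ 3 := mul_le_of_le_one_right (by positivity) hθ
      have h8 : M ^ 2 * (|θ| ^ 3 * |θ|) ≤ M ^ 2 * |θ| ^ 3 := by gcongr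
      linarith
    have h5 := norm_add_le (chi lam μ θ - ((1 - s : ℝ) : ℂ)) (((1 - s : ℝ) : ℂ) - ((Real.exp (-s) : ℝ) : ℂ))
    rw [sub_add_sub_cancel] at h5
    linarith
  have hc1 : ‖chi lam μ θ‖ ≤ 1 := by
    refine (chi_norm lam μ θ hl).trans (Real.exp_le_one_iff.2 ?_)
    have : 0 ≤ lam * (1 - Real.cos θ) := mul_nonneg hl.le (by linarith [Real.cos_le_one θ])
    linarith
  have hc2 : ‖((Real.exp (-s) : ℝ) : ℂ)‖ ≤ 1 := by
    rw [Complex.norm_real, Real.norm_of_nonneg (Real.exp_pos _).le]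
    exact Real.exp_le_one_iff.2 (by linarith)
  have h4 := pow_sub_pow_norm _ _ hc1 hc2 n
  have h5 : (n : ℝ) * ‖chi lam μ θ - ((Real.exp (-s) : ℝ) : ℂ)‖ ≤ n * ((6 * M + M ^ 2) * |θ| ^ 3) := by gcongr
  have h6 := (abs_le.1 (Complex.abs_re_le_norm (chi lam μ θ ^ n - ((Real.exp (-s) : ℝ) : ℂ) ^ n))).1
  rw [Complex.sub_re, ← Complex.ofReal_pow, Complex.ofReal_re, ← Real.exp_nat_mul] at h6
  have h7 : Real.exp (-(n * (M * θ ^ 2))) ≤ Real.exp (n * -s) := by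
    apply Real.exp_le_exp.2
    have : (n : ℝ) * s ≤ n * (M * θ ^ 2) := by gcongr
    linarith
  rw [← Complex.ofReal_pow, ← Real.exp_nat_mul] at h4
  linarith

lemma lower_big (lam0 Lam : ℝ) (h0 : 0 < lam0) :
    ∃ n0 : ℕ, ∃ c : ℝ, 0 < c ∧ ∀ n N : ℕ, 0 < n → n0 ≤ n → ∀ lam : ℝ, lam0 ≤ lam → lam ≤ Lam →
      lam * (Real.exp lam - 1) = ((N : ℝ) / n) * fEx lam → (N : ℝ) / n ≤ 2 + Lam →
      c / √n * fEx lam ^ n ≤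
        (∑ u ∈ Finset.piAntidiag (Finset.univ : Finset (Fin n)) N, ∏ j, wf (u j)) * lam ^ N := by
  have hp := Real.pi_pos
  set M : ℝ := Real.exp (2 * (2 + Lam)) * Real.exp (Real.exp 2 * Lam) / (lam0 ^ 2 / 2) with hMd
  have hM0 : 0 < M := by positivity
  set κ : ℝ := lam0 / (3 * Real.pi ^ 2) with hκd
  have hκ : 0 < κ := by positivity
  set B : ℝ := 6 * M + M ^ 2 with hBd
  have hB : 0 < B := by positivity
  set T : ℝ := max 1 (2 * √(Real.pi / κ) * Real.exp M / κ) with hTd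
  have hT : 1 ≤ T := le_max_left _ _
  have hT2 : 2 * √(Real.pi / κ) * Real.exp M / κ ≤ T := le_max_right _ _
  set R : ℝ := max T (4 * B * T ^ 4 * Real.exp M) with hRd
  have hR1 : T ≤ R := le_max_left _ _
  have hR2 : 4 * B * T ^ 4 * Real.exp M ≤ R := le_max_right _ _
  refine ⟨⌈R ^ 2⌉₊, Real.exp (-M) / (2 * Real.pi), by positivity, ?_⟩
  intro n N hn hn0 lam hl1 hl2 hmu hN
  have hl : 0 < lam := h0.trans_le hl1
  have hnr : R ^ 2 ≤ n := Nat.ceil_le.1 hn0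
  have hn' : (0 : ℝ) < n := by exact_mod_cast hn
  have hRr : R ≤ √n := Real.le_sqrt_of_sq_le hnr
  have hr2 : √(n : ℝ) ^ 2 = n := Real.sq_sqrt hn'.le
  have hf : 0 < fEx lam := fEx_pos hl.ne'
  have hM : Real.exp (2 * ((N : ℝ) / n)) * fEx (Real.exp 2 * lam) / fEx lam ≤ M := by
    rw [hMd]
    have a1 : fEx (Real.exp 2 * lam) ≤ Real.exp (Real.exp 2 * Lam) :=
      (fEx_le_exp _ (by positivity)).trans (Real.exp_le_exp.2 (by gcongr))
    have a2 : lam0 ^ 2 / 2 ≤ fEx lam := le_trans (by gcongr) (fEx_ge lam hl.le)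
    have a3 := fEx_nonneg (Real.exp 2 * lam)
    gcongr
  have L := int_lower (fun θ => (chi lam ((N : ℝ) / n) θ ^ n).re)
    (Complex.continuous_re.comp ((chi_cont lam ((N : ℝ) / n)).pow n)) M B κ T √n hM0.le hB.le hκ hT (hR1.trans hRr)
    (fun θ hθ => by
      rw [hr2]; exact near_bound lam _ hl (by positivity) hmu M hM0.le hM θ hθ n)
    (fun θ hθ => by
      rw [hr2]; exact far_bound lam0 lam _ θ h0 hl1 hθ n)
  have hr0 : 0 < √(n : ℝ) := Real.sqrt_pos.2 hn'
  have hT0 : 0 < T := by linarith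
  have hee : Real.exp (-M) * Real.exp M = 1 := by rw [← Real.exp_add]; simp
  have b1 : 2 * B * T ^ 4 / √n ≤ Real.exp (-M) / 2 := by
    rw [div_le_iff₀ hr0]
    have : 4 * B * T ^ 4 * Real.exp M ≤ √n := hR2.trans hRr
    have h := mul_le_mul_of_nonneg_left this (Real.exp_pos (-M)).le
    have e : Real.exp (-M) * (4 * B * T ^ 4 * Real.exp M) = 4 * B * T ^ 4 := by
      linear_combination (4 * B * T ^ 4) * hee
    rw [e] at h
    linarith
  have b2 : Real.exp (-(κ * T ^ 2)) * √(Real.pi / κ) ≤ Real.exp (-M) / 2 := by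
    have c1 : Real.exp (-(κ * T ^ 2)) ≤ 1 / (κ * T) := by
      rw [Real.exp_neg, ← one_div]
      apply one_div_le_one_div_of_le (by positivity)
      have := Real.add_one_le_exp (κ * T ^ 2)
      have : κ * T ≤ κ * T ^ 2 := by gcongr; nlinarith
      linarith
    have c2 : 2 * √(Real.pi / κ) * Real.exp M ≤ κ * T := by
      rw [div_le_iff₀ hκ] at hT2; linarith
    have c3 := mul_le_mul_of_nonneg_left c2 (Real.exp_pos (-M)).le
    have c4 : 2 * √(Real.pi / κ) ≤ Real.exp (-M) * (κ * T) := by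
      have e : Real.exp (-M) * (2 * √(Real.pi / κ) * Real.exp M) = 2 * √(Real.pi / κ) := by
        linear_combination (2 * √(Real.pi / κ)) * hee
      rw [e] at c3; exact c3
    calc _ ≤ 1 / (κ * T) * √(Real.pi / κ) := by gcongr
      _ = √(Real.pi / κ) / (κ * T) := by ring
      _ ≤ _ := by rw [div_le_iff₀ (by positivity)]; linarith
  have L2 : 1 / √(n : ℝ) * Real.exp (-M) ≤ ∫ θ in (-Real.pi)..Real.pi, (chi lam ((N : ℝ) / n) θ ^ n).re := by
    refine le_trans ?_ L
    gcongr
    linarith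
  have C := coef_int hn N lam hl
  have L3 := mul_le_mul_of_nonneg_left L2 (pow_pos hf n).le
  rw [← C] at L3
  have e : Real.exp (-M) / (2 * Real.pi) / √n * fEx lam ^ n = (fEx lam ^ n * (1 / √n * Real.exp (-M))) / (2 * Real.pi) := by
    field_simp
  rw [e, div_le_iff₀ (by positivity)]
  linarith

lemma coef_small {n N : ℕ} (hn : 0 < n) (hN : 2 * n ≤ N) :
    ((N.factorial : ℝ)⁻¹) ^ n ≤ ∑ u ∈ Finset.piAntidiag (Finset.univ : Finset (Fin n)) N, ∏ j, wf (u j) := by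
  obtain ⟨p, rfl⟩ : ∃ p, n = p + 1 := ⟨n - 1, by omega⟩
  set u : Fin (p + 1) → ℕ := Fin.cons (N - 2 * p) (fun _ => 2) with hu
  have hmem : u ∈ Finset.piAntidiag (Finset.univ : Finset (Fin (p + 1))) N := by
    rw [Finset.mem_piAntidiag]
    refine ⟨?_, fun _ _ => Finset.mem_univ _⟩
    rw [Fin.sum_univ_succ]
    simp only [hu, Fin.cons_zero, Fin.cons_succ, Finset.sum_const, Finset.card_univ, Fintype.card_fin, smul_eq_mul]
    omega
  have hu2 : ∀ j, 2 ≤ u j ∧ u j ≤ N := by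
    intro j
    refine Fin.cases ?_ ?_ j
    · simp only [hu, Fin.cons_zero]; omega
    · intro i; simp only [hu, Fin.cons_succ]; omega
  refine le_trans ?_ (Finset.single_le_sum (f := fun u : Fin (p + 1) → ℕ => ∏ j, wf (u j))
    (fun v _ => Finset.prod_nonneg fun j _ => wf_nonneg (v j)) hmem)
  have : ((N.factorial : ℝ)⁻¹) ^ (p + 1) = ∏ _j : Fin (p + 1), (N.factorial : ℝ)⁻¹ := by simp
  rw [this]
  refine Finset.prod_le_prod (fun _ _ => by positivity) ?_
  intro j _
  unfold wf
  rw [if_pos (hu2 j).1]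
  have : ((u j).factorial : ℝ) ≤ N.factorial := by exact_mod_cast Nat.factorial_le (hu2 j).2
  gcongr

lemma lower_all (lam0 Lam : ℝ) (h0 : 0 < lam0) :
    ∃ c : ℝ, 0 < c ∧ ∀ n N : ℕ, 0 < n → 2 * n ≤ N → ∀ lam : ℝ, lam0 ≤ lam → lam ≤ Lam →
      lam * (Real.exp lam - 1) = ((N : ℝ) / n) * fEx lam → (N : ℝ) / n ≤ 2 + Lam →
      c / √n * fEx lam ^ n ≤
        (∑ u ∈ Finset.piAntidiag (Finset.univ : Finset (Fin n)) N, ∏ j, wf (u j)) * lam ^ N := by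
  obtain ⟨n0, c, hc, H⟩ := lower_big lam0 Lam h0
  set N0 : ℕ := ⌈(2 + Lam) * n0⌉₊ with hN0
  set q : ℝ := min lam0 1 with hq
  have hq0 : 0 < q := lt_min h0 one_pos
  set c' : ℝ := ((N0.factorial : ℝ)⁻¹) ^ n0 * q ^ N0 / Real.exp Lam ^ n0 with hc'
  have hc'0 : 0 < c' := by positivity
  refine ⟨min c c', lt_min hc hc'0, ?_⟩
  intro n N hn h2 lam hl1 hl2 hmu hN
  have hl : 0 < lam := h0.trans_le hl1
  have hf : 0 < fEx lam := fEx_pos hl.ne'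
  have hn' : (0 : ℝ) < n := by exact_mod_cast hn
  rcases le_or_gt n0 n with hc0 | hc0
  · refine le_trans ?_ (H n N hn hc0 lam hl1 hl2 hmu hN)
    have := min_le_left c c'
    gcongr
  · have hnn : n ≤ n0 := hc0.le
    have hNN : N ≤ N0 := by
      have : (N : ℝ) ≤ N0 := by
        rw [div_le_iff₀ hn'] at hN
        have h3 : (n : ℝ) ≤ n0 := by exact_mod_cast hnn
        have : (2 + Lam) * n ≤ (2 + Lam) * n0 := by
          have : 0 < 2 + Lam := by linarith
          gcongr
        have := Nat.le_ceil ((2 + Lam) * n0)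
        linarith
      exact_mod_cast this
    have a1 : ((N0.factorial : ℝ)⁻¹) ^ n0 ≤ ((N.factorial : ℝ)⁻¹) ^ n := by
      have b1 : (1 : ℝ) ≤ N0.factorial := by exact_mod_cast Nat.one_le_iff_ne_zero.2 (Nat.factorial_ne_zero _)
      have b2 : (N.factorial : ℝ) ≤ N0.factorial := by exact_mod_cast Nat.factorial_le hNN
      calc _ ≤ ((N0.factorial : ℝ)⁻¹) ^ n := pow_le_pow_of_le_one (by positivity) (inv_le_one_of_one_le₀ b1) hnn
        _ ≤ _ := by gcongr
    have a2 : q ^ N0 ≤ lam ^ N := by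
      calc q ^ N0 ≤ q ^ N := pow_le_pow_of_le_one hq0.le (min_le_right _ _) hNN
        _ ≤ _ := by
          have := min_le_left lam0 1
          gcongr
          linarith
    have a3 : fEx lam ^ n ≤ Real.exp Lam ^ n0 := by
      calc fEx lam ^ n ≤ Real.exp Lam ^ n := by
            have := (fEx_le_exp lam hl.le).trans (Real.exp_le_exp.2 hl2)
            gcongr
        _ ≤ _ := pow_le_pow_right₀ (Real.one_le_exp (by linarith)) hnn
    have a4 := coef_small hn h2
    have a5 : min c c' / √n ≤ c' := by
      have h1 : (1 : ℝ) ≤ √n := by rw [Real.one_le_sqrt]; exact_mod_cast hn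
      calc min c c' / √n ≤ c' / √n := by gcongr; exact min_le_right _ _
        _ ≤ c' / 1 := by gcongr
        _ = c' := div_one _
    calc min c c' / √n * fEx lam ^ n ≤ c' * Real.exp Lam ^ n0 := by gcongr
      _ = ((N0.factorial : ℝ)⁻¹) ^ n0 * q ^ N0 := by rw [hc']; field_simp
      _ ≤ _ := mul_le_mul (a1.trans a4) a2 (by positivity) (le_trans (by positivity) (a1.trans a4))

lemma psi_facts (lam : ℝ) (hl : 0 < lam) :
    lam ≤ psi lam ∧ psi lam ≤ 2 + lam ∧ lam * (Real.exp lam - 1) = psi lam * fEx lam := by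
  have hf : 0 < fEx lam := fEx_pos hl.ne'
  have e : psi lam = lam * (Real.exp lam - 1) / fEx lam := by
    unfold psi fEx; rw [if_neg hl.ne']
  refine ⟨?_, ?_, ?_⟩
  · rw [e, le_div_iff₀ hf]; unfold fEx; nlinarith
  · rw [e, div_le_iff₀ hf]
    have := Real.quadratic_le_exp_of_nonneg hl.le
    unfold fEx; nlinarith
  · rw [e]; field_simp

lemma fact_upper (n : ℕ) (hn : 0 < n) : (n.factorial : ℝ) ≤ Real.exp 1 * √n * (n / Real.exp 1) ^ n := by
  obtain ⟨p, rfl⟩ : ∃ p, n = p + 1 := ⟨n - 1, by omega⟩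
  have h := Stirling.stirlingSeq'_antitone (Nat.zero_le p)
  simp only [Function.comp] at h
  rw [Nat.succ_eq_add_one, Nat.succ_eq_add_one, zero_add, Stirling.stirlingSeq_one] at h
  unfold Stirling.stirlingSeq at h
  rw [div_le_iff₀ (by positivity)] at h
  refine h.trans (le_of_eq ?_)
  rw [Real.sqrt_mul (by norm_num)]
  have : √(2 : ℝ) ≠ 0 := by positivity
  field_simp

lemma fact_lower (n : ℕ) : √(2 * Real.pi * n) * (n / Real.exp 1) ^ n ≤ (n.factorial : ℝ) :=
  Stirling.le_factorial_stirling n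

lemma fact_lower' (n : ℕ) : √(n : ℝ) * (n / Real.exp 1) ^ n ≤ (n.factorial : ℝ) := by
  refine le_trans ?_ (fact_lower n)
  have : (n : ℝ) ≤ 2 * Real.pi * n := by
    have := Real.pi_gt_three
    have h : (0 : ℝ) ≤ n := by positivity
    nlinarith
  gcongr

noncomputable def PP (k ℓ r : ℕ) : ℝ :=
  (((ℓ : ℝ) / ((ℓ + r : ℕ) : ℝ)) ^ ℓ * ((r : ℝ) / ((ℓ + r : ℕ) : ℝ)) ^ r)⁻¹ *
    (((ℓ : ℝ) / ((ℓ + r : ℕ) : ℝ)) ^ (ℓ * k) * ((r : ℝ) / ((ℓ + r : ℕ) : ℝ)) ^ (r * k))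

lemma binom_ratio (k ℓ r : ℕ) (hk : 1 ≤ k) (hℓ : 1 ≤ ℓ) :
    ((ℓ + r).choose ℓ : ℝ) * (((ℓ * k).factorial : ℝ) * ((r * k).factorial : ℝ))
      ≤ Real.exp 1 ^ 3 * √k * PP k ℓ r * (((ℓ + r) * k).factorial : ℝ) := by
  have hk1 : (1 : ℝ) ≤ √k := by rw [Real.one_le_sqrt]; exact_mod_cast hk
  have he1 : (1 : ℝ) ≤ Real.exp 1 ^ 3 := one_le_pow₀ (Real.one_le_exp (by norm_num))
  rcases Nat.eq_zero_or_pos r with rfl | hr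
  · have hl0 : (ℓ : ℝ) ≠ 0 := by positivity
    have : PP k ℓ 0 = 1 := by unfold PP; simp [hl0]
    rw [this]
    simp only [add_zero, Nat.choose_self, zero_mul, Nat.factorial_zero, Nat.cast_one, mul_one, one_mul]
    exact le_mul_of_one_le_left (by positivity) (by nlinarith)
  · have hchoose : ((ℓ + r).choose ℓ : ℝ) = ((ℓ + r).factorial : ℝ) / ((ℓ.factorial : ℝ) * (r.factorial : ℝ)) := by
      rw [Nat.cast_add_choose]
    have u1 := fact_upper (ℓ + r) (by omega)
    have u2 := fact_upper (ℓ * k) (by positivity)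
    have u3 := fact_upper (r * k) (by positivity)
    have l1 := fact_lower' ℓ
    have l2 := fact_lower' r
    have l3 := fact_lower' ((ℓ + r) * k)
    have hl' : (0 : ℝ) < ℓ := by exact_mod_cast hℓ
    have hr' : (0 : ℝ) < r := by exact_mod_cast hr
    have hk' : (0 : ℝ) < k := by exact_mod_cast hk
    have hm' : (0 : ℝ) < ((ℓ + r : ℕ) : ℝ) := by positivity
    rw [hchoose, div_mul_eq_mul_div, div_le_iff₀ (by positivity)]
    have hP : 0 < PP k ℓ r := by unfold PP; positivity
    calc _ ≤ (Real.exp 1 * √((ℓ + r : ℕ) : ℝ) * (((ℓ + r : ℕ) : ℝ) / Real.exp 1) ^ (ℓ + r)) *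
          ((Real.exp 1 * √((ℓ * k : ℕ) : ℝ) * (((ℓ * k : ℕ) : ℝ) / Real.exp 1) ^ (ℓ * k)) *
          (Real.exp 1 * √((r * k : ℕ) : ℝ) * (((r * k : ℕ) : ℝ) / Real.exp 1) ^ (r * k))) := by gcongr
      _ = Real.exp 1 ^ 3 * √k * PP k ℓ r *
          (√((((ℓ + r) * k : ℕ)) : ℝ) * ((((ℓ + r) * k : ℕ) : ℝ) / Real.exp 1) ^ ((ℓ + r) * k)) *
          ((√(ℓ : ℝ) * ((ℓ : ℝ) / Real.exp 1) ^ ℓ) * (√(r : ℝ) * ((r : ℝ) / Real.exp 1) ^ r)) := by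
        unfold PP
        rw [Nat.cast_mul (ℓ + r) k, Nat.cast_mul ℓ k, Nat.cast_mul r k]
        generalize ((ℓ + r : ℕ) : ℝ) = m at *
        rw [Real.sqrt_mul hm'.le, Real.sqrt_mul hl'.le, Real.sqrt_mul hr'.le]
        have hE := Real.exp_pos 1
        generalize Real.exp 1 = E at *
        simp only [div_pow, mul_pow, add_mul, pow_add, mul_inv]
        field_simp
      _ ≤ _ := by gcongr

lemma exp_log_pow (x : ℝ) (a : ℕ) (h : 0 < x ∨ a = 0) : Real.exp (a * Real.log x) = x ^ a := by
  rcases h with h | rfl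
  · rw [Real.exp_nat_mul, Real.exp_log h]
  · simp

lemma exp_Hk (k ℓ r n : ℕ) (hℓ : 1 ≤ ℓ) (hn : 0 < n) (z1 z2 lam : ℝ) (h1 : 0 < z1) (h2 : 0 < z2) (hl : 0 < lam) :
    Real.exp ((n : ℝ) * HkF k ((ℓ : ℝ) / ((ℓ + r : ℕ) : ℝ)) z1 z2 (((ℓ + r : ℕ) : ℝ) / (n : ℝ)) lam)
      = PP k ℓ r / (z1 ^ (ℓ * k) * z2 ^ (r * k)) *
        ((fEx (lam * (z2 + z1)) + fEx (lam * (z2 - z1))) / (2 * fEx lam)) ^ n := by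
  have hl' : (0 : ℝ) < ℓ := by exact_mod_cast hℓ
  have hn' : (0 : ℝ) < n := by exact_mod_cast hn
  have hm' : (0 : ℝ) < ((ℓ + r : ℕ) : ℝ) := by positivity
  have hf : 0 < fEx lam := fEx_pos hl.ne'
  have hg : 0 < (fEx (lam * (z2 + z1)) + fEx (lam * (z2 - z1))) / (2 * fEx lam) := by
    have := fEx_pos (y := lam * (z2 + z1)) (by positivity)
    have := fEx_nonneg (lam * (z2 - z1))
    positivity
  have hβ : 1 - (ℓ : ℝ) / ((ℓ + r : ℕ) : ℝ) = (r : ℝ) / ((ℓ + r : ℕ) : ℝ) := by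
    field_simp; push_cast; ring
  unfold HkF Hent PP
  rw [hβ]
  set α : ℝ := (ℓ : ℝ) / ((ℓ + r : ℕ) : ℝ) with hα
  set β : ℝ := (r : ℝ) / ((ℓ + r : ℕ) : ℝ) with hβd
  have hα0 : 0 < α := by positivity
  have hβ0 : 0 < β ∨ r = 0 := by
    rcases Nat.eq_zero_or_pos r with h | h
    · exact Or.inr h
    · left; positivity
  have hβz : 0 < β / z2 ∨ r * k = 0 := by
    rcases hβ0 with h | h
    · left; positivity
    · right; simp [h]
  set G := (fEx (lam * (z2 + z1)) + fEx (lam * (z2 - z1))) / (2 * fEx lam) with hG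
  have ea : ((ℓ + r : ℕ) : ℝ) * α = ℓ := by rw [hα]; field_simp
  have eb : ((ℓ + r : ℕ) : ℝ) * β = r := by rw [hβd]; field_simp
  have e : (n : ℝ) * (((ℓ + r : ℕ) : ℝ) / n * (-(α * Real.log α) - β * Real.log β)
      + ((ℓ + r : ℕ) : ℝ) / n * k * α * Real.log (α / z1) + ((ℓ + r : ℕ) : ℝ) / n * k * β * Real.log (β / z2) + Real.log G)
      = -((ℓ : ℝ) * Real.log α) + -((r : ℝ) * Real.log β) + ((ℓ * k : ℕ) : ℝ) * Real.log (α / z1)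
        + ((r * k : ℕ) : ℝ) * Real.log (β / z2) + n * Real.log G := by
    have hnm : (n : ℝ) * (((ℓ + r : ℕ) : ℝ) / n) = ((ℓ + r : ℕ) : ℝ) := by field_simp
    rw [Nat.cast_mul ℓ k, Nat.cast_mul r k]
    linear_combination (-(α * Real.log α) - β * Real.log β + k * α * Real.log (α / z1) + k * β * Real.log (β / z2)) * hnm
      + (-Real.log α + k * Real.log (α / z1)) * ea + (-Real.log β + k * Real.log (β / z2)) * eb
  rw [e, Real.exp_add, Real.exp_add, Real.exp_add, Real.exp_add, Real.exp_neg, Real.exp_neg,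
    exp_log_pow α ℓ (Or.inl hα0), exp_log_pow β r hβ0, exp_log_pow _ _ (Or.inl (by positivity : 0 < α / z1)),
    exp_log_pow _ _ hβz, exp_log_pow G n (Or.inl hg), div_pow α z1, div_pow β z2, mul_inv]
  field_simp

lemma final_calc {lam z1 z2 nr f c l0 K g P U V ch Fl Fr FN E sk : ℝ} {a b N n : ℕ}
    (hl : 0 < lam) (hz1 : 0 < z1) (hz2 : 0 < z2) (hn : 0 < nr) (hf : 0 < f) (hc : 0 < c) (hl0 : 0 < l0) (hll : l0 ≤ lam)
    (hK : 0 ≤ K) (hg : 0 ≤ g) (hP : 0 ≤ P) (hFN : 0 < FN) (hnum : 0 ≤ ch * (Fl * Fr)) (hE : 0 ≤ E * sk)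
    (hN : N = a + b)
    (hV : c / √nr * f ^ n ≤ V * lam ^ N)
    (hU : U * ((lam * z1) ^ a * (lam * z2) ^ b) ≤ K / √(nr * (lam * z2)) * (g / 2) ^ n)
    (hB : ch * (Fl * Fr) ≤ E * sk * P * FN) :
    ch * (Fl * Fr * U) / (FN * V) ≤ E * sk * K / (c * √l0) / √z2 * (P / (z1 ^ a * z2 ^ b) * (g / (2 * f)) ^ n) := by
  subst hN
  have hVpos : 0 < V := by
    have h : 0 < V * lam ^ (a + b) := lt_of_lt_of_le (by positivity) hV
    exact pos_of_mul_pos_left h (by positivity)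
  have hU' : U ≤ K / √(nr * (lam * z2)) * (g / 2) ^ n / ((lam * z1) ^ a * (lam * z2) ^ b) := by
    rw [le_div_iff₀ (by positivity)]; exact hU
  have hV' : c / √nr * f ^ n / lam ^ (a + b) ≤ V := by
    rw [div_le_iff₀ (by positivity)]; exact hV
  have hsl : √l0 ≤ √lam := Real.sqrt_le_sqrt hll
  have hsl0 : 0 < √l0 := Real.sqrt_pos.2 hl0
  set Ub := K / √(nr * (lam * z2)) * (g / 2) ^ n / ((lam * z1) ^ a * (lam * z2) ^ b) with hUb
  set Vb := c / √nr * f ^ n / lam ^ (a + b) with hVb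
  have hUb0 : 0 ≤ Ub := by positivity
  have hVb0 : 0 < Vb := by positivity
  have s1 : U / V ≤ Ub / Vb := by
    calc U / V ≤ Ub / V := by gcongr
      _ ≤ Ub / Vb := by gcongr
  have s2 : Ub / Vb = K / (c * √lam) / √z2 * (1 / (z1 ^ a * z2 ^ b) * (g / (2 * f)) ^ n) := by
    rw [hUb, hVb, Real.sqrt_mul hn.le, Real.sqrt_mul hl.le]
    simp only [div_pow, mul_pow, pow_add]
    have := Real.sqrt_pos.2 hn
    have := Real.sqrt_pos.2 hl
    have := Real.sqrt_pos.2 hz2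
    field_simp
  have s3 : Ub / Vb ≤ K / (c * √l0) / √z2 * (1 / (z1 ^ a * z2 ^ b) * (g / (2 * f)) ^ n) := by
    rw [s2]; gcongr
  have s4 : ch * (Fl * Fr) / FN ≤ E * sk * P := by rw [div_le_iff₀ hFN]; exact hB
  calc ch * (Fl * Fr * U) / (FN * V) = (ch * (Fl * Fr) / FN) * (U / V) := by field_simp
    _ ≤ (ch * (Fl * Fr) / FN) * (Ub / Vb) := by gcongr
    _ ≤ (E * sk * P) * (K / (c * √l0) / √z2 * (1 / (z1 ^ a * z2 ^ b) * (g / (2 * f)) ^ n)) := by gcongr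
    _ = _ := by ring

theorem expected_critical_sets_bound
    (k : ℕ) (hk : 3 ≤ k) (c₁ c₂ : ℝ) (hc₁ : 2 / k < c₁) (hc₁₂ : c₁ ≤ c₂) :
    ∃ K : ℝ, ∀ m n : ℕ, 0 < m → 0 < n →
      c₁ ≤ (m : ℝ) / (n : ℝ) → (m : ℝ) / (n : ℝ) ≤ c₂ →
      ∀ ℓ : ℕ, 1 ≤ ℓ → ℓ ≤ m →
      ∀ z1 z2 : ℝ, 0 < z1 → 0 < z2 →
      ∀ lam : ℝ, 0 < lam → psi lam = ((m : ℝ) / (n : ℝ)) * k →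
      EY k m n ℓ ≤ K / Real.sqrt z2 *
        Real.exp ((n : ℝ) * HkF k ((ℓ : ℝ) / (m : ℝ)) z1 z2 ((m : ℝ) / (n : ℝ)) lam) := by
  have hk0 : (0 : ℝ) < k := by positivity
  have hc1k : 0 < c₁ * k - 2 := by
    rw [div_lt_iff₀ hk0] at hc₁; linarith
  obtain ⟨c, hc, H⟩ := lower_all (c₁ * k - 2) (c₂ * k) hc1k
  refine ⟨Real.exp 1 ^ 3 * √k * K0 / (c * √(c₁ * k - 2)), ?_⟩
  intro m n hm hn h1 h2 ℓ hℓ hℓm z1 z2 hz1 hz2 lam hl hpsi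
  obtain ⟨r, rfl⟩ := Nat.exists_eq_add_of_le hℓm
  have hn' : (0 : ℝ) < n := by exact_mod_cast hn
  have hf : 0 < fEx lam := fEx_pos hl.ne'
  obtain ⟨p1, p2, p3⟩ := psi_facts lam hl
  have e1 : ((((ℓ + r) * k : ℕ)) : ℝ) / n = psi lam := by
    rw [hpsi, Nat.cast_mul]; ring
  have q1 : c₁ * k ≤ psi lam := by rw [hpsi]; gcongr
  have q2 : psi lam ≤ c₂ * k := by rw [hpsi]; gcongr
  have hl0 : c₁ * k - 2 ≤ lam := by linarith
  have hN2 : 2 * n ≤ (ℓ + r) * k := by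
    have : (2 : ℝ) ≤ ((((ℓ + r) * k : ℕ)) : ℝ) / n := by rw [e1]; linarith
    rw [le_div_iff₀ hn'] at this
    exact_mod_cast this
  have V := H n ((ℓ + r) * k) hn hN2 lam hl0 (by linarith) (by rw [e1]; exact p3) (by rw [e1]; linarith)
  have U := upper2 hn (lam * z1) (lam * z2) (by positivity) (by positivity) (ℓ * k) (r * k)
  have Bn := binom_ratio k ℓ r (by omega) hℓ
  rw [exp_Hk k ℓ r n hℓ hn z1 z2 lam hz1 hz2 hl]
  unfold EY
  rw [numer, card_chip, Nat.add_sub_cancel_left]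
  rw [← mul_add, ← mul_sub] at U
  exact final_calc hl hz1 hz2 hn' hf hc hc1k hl0 (by unfold K0; positivity)
    (by
      have := fEx_nonneg (lam * (z2 + z1))
      have := fEx_nonneg (lam * (z2 - z1))
      positivity) (by unfold PP; positivity) (by positivity) (by positivity) (by positivity) (by ring) V U Bn
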